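/- arXiv:1411.5888 — 3 statements merged into one kernel-verified Lean document; each statement's English description precedes it below -/
import Mathlib

section
/- Suppose Condition 4.3 holds with parameters θ₂, θ₃. Then for every j = 1,…,d and every γ ∈ (0, min{ 1/(2(1−θ₂)), θ₃ }): K_{nj}(γ) := sup | s(1−s) / (ξ(1−ξ)) | = O_P(1), where the supremum is taken over all s ∈ [n^{−γ}, 1−n^{−γ}] and all ξ lying between G_{nj}^−(s) and s. -/
open MeasureTheory Filter Set
open scoped ENNReal NNReal

noncomputable section

namespace BBV

variable {Ω : Type*} [MeasurableSpace Ω] {E : Type*} [MeasurableSpace E] {d : ℕ}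

/-- The real-valued indicator function of a set. -/
def indic {α : Type*} (s : Set α) (x : α) : ℝ := s.indicator (fun _ => (1 : ℝ)) x

/-- `Z n = o_P(r n)`: convergence to zero in (outer) probability at rate `r`. -/
def oP (P : Measure Ω) (Z : ℕ → Ω → ℝ) (r : ℕ → ℝ) : Prop :=
  ∀ ε : ℝ, 0 < ε → Tendsto (fun n => P {ω | ε * r n < |Z n ω|}) atTop (nhds 0)

/-- `Z n = o_P(1)`: convergence to zero in (outer) probability. -/
def oP1 (P : Measure Ω) (Z : ℕ → Ω → ℝ) : Prop := oP P Z fun _ => 1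

/-- `Z n = O_P(1)`: boundedness in (outer) probability. -/
def bigOP (P : Measure Ω) (Z : ℕ → Ω → ℝ) : Prop :=
  ∀ ε : ℝ, 0 < ε → ∃ M : ℝ, ∀ᶠ n in atTop, P {ω | M < |Z n ω|} ≤ ENNReal.ofReal ε

/-- Strict stationarity of a two-sided sequence: all finite-dimensional distributions
are invariant under shifts. -/
def StrictlyStationary (P : Measure Ω) (X : ℤ → Ω → E) : Prop :=
  ∀ (m : ℕ) (idx : Fin m → ℤ) (k : ℤ),
    Measure.map (fun ω (p : Fin m) => X (idx p + k) ω) P =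
      Measure.map (fun ω (p : Fin m) => X (idx p) ω) P

/-- The sigma-field generated by the variables `X i`, `i ∈ S`. -/
def mixSigma (X : ℤ → Ω → E) (S : Set ℤ) : MeasurableSpace Ω :=
  ⨆ i ∈ S, MeasurableSpace.comap (X i) inferInstance

/-- The alpha-mixing coefficient of the sequence `X`. -/
def alphaMix (P : Measure Ω) (X : ℤ → Ω → E) (k : ℕ) : ℝ :=
  sSup {r : ℝ | ∃ (i : ℤ) (A B : Set Ω),
    MeasurableSet[mixSigma X (Set.Iic i)] A ∧
    MeasurableSet[mixSigma X (Set.Ici (i + (k : ℤ)))] B ∧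
    r = |(P (A ∩ B)).toReal - (P A).toReal * (P B).toReal|}

/-- Exponentially decaying alpha-mixing coefficients: `α(k) = O(a^k)` for some `a ∈ (0,1)`. -/
def ExpAlphaMixing (P : Measure Ω) (X : ℤ → Ω → E) : Prop :=
  ∃ a ∈ Set.Ioo (0 : ℝ) 1, ∃ c : ℝ, ∀ k : ℕ, 1 ≤ k → alphaMix P X k ≤ c * a ^ k

/-- Marginal c.d.f. `F_j` of the stationary sequence. -/
def margF (P : Measure Ω) (X : ℤ → Ω → Fin d → ℝ) (j : Fin d) (x : ℝ) : ℝ :=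
  (P {ω | X 0 ω j ≤ x}).toReal

/-- `U_i = (F_1(X_{i1}),…,F_d(X_{id}))`. -/
def Uv (P : Measure Ω) (X : ℤ → Ω → Fin d → ℝ) (i : ℤ) (ω : Ω) (j : Fin d) : ℝ :=
  margF P X j (X i ω j)

/-- The copula `C` of the stationary distribution, i.e. the c.d.f. of `U_0`. -/
def cop (P : Measure Ω) (X : ℤ → Ω → Fin d → ℝ) (u : Fin d → ℝ) : ℝ :=
  (P {ω | ∀ j, Uv P X 0 ω j ≤ u j}).toReal

/-- Empirical c.d.f. `G_n` of the (unobservable) sample `U_1,…,U_n`. -/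
def Gn (P : Measure Ω) (X : ℤ → Ω → Fin d → ℝ) (n : ℕ) (u : Fin d → ℝ) (ω : Ω) : ℝ :=
  (n : ℝ)⁻¹ * ∑ i ∈ Finset.Icc (1 : ℤ) (n : ℤ), indic {ω' | ∀ j, Uv P X i ω' j ≤ u j} ω

/-- The empirical process `α_n = √n (G_n − C)`. -/
def alphan (P : Measure Ω) (X : ℤ → Ω → Fin d → ℝ) (n : ℕ) (u : Fin d → ℝ) (ω : Ω) : ℝ :=
  Real.sqrt n * (Gn P X n u ω - cop P X u)

/-- Marginal empirical c.d.f. `G_{nj}` based on `U_{1j},…,U_{nj}`. -/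
def Gnj (P : Measure Ω) (X : ℤ → Ω → Fin d → ℝ) (n : ℕ) (j : Fin d) (s : ℝ) (ω : Ω) : ℝ :=
  (n : ℝ)⁻¹ * ∑ i ∈ Finset.Icc (1 : ℤ) (n : ℤ), indic {ω' | Uv P X i ω' j ≤ s} ω

/-- The marginal empirical process `α_{nj}(s) = √n (G_{nj}(s) − s)`. -/
def alphanj (P : Measure Ω) (X : ℤ → Ω → Fin d → ℝ) (n : ℕ) (j : Fin d) (s : ℝ) (ω : Ω) : ℝ :=
  Real.sqrt n * (Gnj P X n j s ω - s)

/-- Left-continuous generalized inverse: `H⁻(s) = inf{x : H(x) ≥ s}` for `s ≠ 0`,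
and `H⁻(0) = sup{x : H(x) = 0}`. -/
def genInv (H : ℝ → ℝ) (s : ℝ) : ℝ :=
  if s = 0 then sSup {x | H x = 0} else sInf {x | s ≤ H x}

/-- The marginal quantile process `β_{nj}(s) = √n (G_{nj}⁻(s) − s)`. -/
def betanj (P : Measure Ω) (X : ℤ → Ω → Fin d → ℝ) (n : ℕ) (j : Fin d) (s : ℝ) (ω : Ω) : ℝ :=
  Real.sqrt n * (genInv (fun x => Gnj P X n j x ω) s - s)

/-- Marginal empirical c.d.f. `F_{nj}` of the observations `X_{1j},…,X_{nj}`. -/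
def empCdfX (X : ℤ → Ω → Fin d → ℝ) (n : ℕ) (j : Fin d) (x : ℝ) (ω : Ω) : ℝ :=
  (n : ℝ)⁻¹ * ∑ i ∈ Finset.Icc (1 : ℤ) (n : ℤ), indic {ω' | X i ω' j ≤ x} ω

/-- Pseudo-observations `Û_{ij} = n/(n+1) · F_{nj}(X_{ij})`. -/
def pseudoObs (X : ℤ → Ω → Fin d → ℝ) (n : ℕ) (i : ℤ) (ω : Ω) (j : Fin d) : ℝ :=
  (n : ℝ) / ((n : ℝ) + 1) * empCdfX X n j (X i ω j) ω

/-- The empirical copula `Ĉ_n`. -/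
def empCop (X : ℤ → Ω → Fin d → ℝ) (n : ℕ) (u : Fin d → ℝ) (ω : Ω) : ℝ :=
  (n : ℝ)⁻¹ * ∑ i ∈ Finset.Icc (1 : ℤ) (n : ℤ), indic {ω' | ∀ j, pseudoObs X n i ω' j ≤ u j} ω

/-- The empirical copula process `ĈP_n = √n (Ĉ_n − C)`. -/
def hatCP (P : Measure Ω) (X : ℤ → Ω → Fin d → ℝ) (n : ℕ) (u : Fin d → ℝ) (ω : Ω) : ℝ :=
  Real.sqrt n * (empCop X n u ω - cop P X u)

/-- First-order partial derivative `Ċ_j` of `C`, defined everywhere as the limsup of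
difference quotients (which coincides with the partial derivative wherever it exists). -/
def Cdot (C : (Fin d → ℝ) → ℝ) (j : Fin d) (u : Fin d → ℝ) : ℝ :=
  Filter.limsup (fun h : ℝ => (C (Function.update u j (u j + h)) - C u) / h)
    (nhdsWithin 0 {(0 : ℝ)}ᶜ)

/-- The process `C̄_n(u) = α_n(u) − Σ_j Ċ_j(u) α_n(u^{(j)})`. -/
def Cbar (P : Measure Ω) (X : ℤ → Ω → Fin d → ℝ) (n : ℕ) (u : Fin d → ℝ) (ω : Ω) : ℝ :=
  alphan P X n u ω -
    ∑ j, Cdot (cop P X) j u * alphan P X n (Function.update (fun _ => (1 : ℝ)) j (u j)) ω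

/-- `C_n(u) = G_n(G_{n1}⁻(u₁),…,G_{nd}⁻(u_d))`. -/
def copGI (P : Measure Ω) (X : ℤ → Ω → Fin d → ℝ) (n : ℕ) (u : Fin d → ℝ) (ω : Ω) : ℝ :=
  Gn P X n (fun j => genInv (fun x => Gnj P X n j x ω) (u j)) ω

/-- The empirical copula process `𝔺_n = √n (C_n − C)` based on generalized inverses. -/
def CPgi (P : Measure Ω) (X : ℤ → Ω → Fin d → ℝ) (n : ℕ) (u : Fin d → ℝ) (ω : Ω) : ℝ :=
  Real.sqrt n * (copGI P X n u ω - cop P X u)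

/-- `g₁(u) = min{ min_j u_j , min_j [1 − min_{k ≠ j} u_k] }`. -/
def g1 (u : Fin d → ℝ) : ℝ :=
  min (⨅ j, u j) (⨅ j : Fin d, (1 - ⨅ k : {k : Fin d // k ≠ j}, u (k : Fin d)))

/-- The weight function `g_ω(u) = g₁(u)^ω`. -/
def gW (w : ℝ) (u : Fin d → ℝ) : ℝ := g1 u ^ w

/-- `g̃_ω(u) = g_ω(u) + 1{g_ω(u) = 0}`. -/
def gTilde (w : ℝ) (u : Fin d → ℝ) : ℝ := if gW w u = 0 then 1 else gW w u

/-- `N(a,b) = {u ∈ [0,1]^d : a < g₁(u) ≤ b}`. -/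
def NN (d : ℕ) (a b : ℝ) : Set (Fin d → ℝ) :=
  {u | (∀ j, 0 ≤ u j ∧ u j ≤ 1) ∧ a < g1 u ∧ g1 u ≤ b}

/-- `V_j = {u ∈ [0,1]^d : u_j ∈ (0,1)}`. -/
def VV (d : ℕ) (j : Fin d) : Set (Fin d → ℝ) :=
  {u | (∀ k, 0 ≤ u k ∧ u k ≤ 1) ∧ 0 < u j ∧ u j < 1}

/-- Condition 2.1: existence, continuity and growth bounds for the first and second
order partial derivatives of the copula `C`. -/
def Condition21 (C : (Fin d → ℝ) → ℝ) : Prop :=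
  (∀ j : Fin d, ∀ u ∈ VV d j,
    HasDerivAt (fun t => C (Function.update u j t)) (Cdot C j u) (u j)) ∧
  (∀ j : Fin d, ContinuousOn (Cdot C j) (VV d j)) ∧
  ∃ Cdd : Fin d → Fin d → (Fin d → ℝ) → ℝ,
    (∀ j₁ j₂ : Fin d, ∀ u ∈ VV d j₁ ∩ VV d j₂,
      HasDerivAt (fun t => Cdot C j₂ (Function.update u j₁ t)) (Cdd j₁ j₂ u) (u j₁)) ∧
    (∀ j₁ j₂ : Fin d, ContinuousOn (Cdd j₁ j₂) (VV d j₁ ∩ VV d j₂)) ∧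
    ∃ K : ℝ, 0 < K ∧ ∀ j₁ j₂ : Fin d, ∀ u ∈ VV d j₁ ∩ VV d j₂,
      |Cdd j₁ j₂ u| ≤ K * min (1 / (u j₁ * (1 - u j₁))) (1 / (u j₂ * (1 - u j₂)))

/-- The weighted modulus of continuity `M_n(δ,μ)` of the empirical process. -/
def Mn (P : Measure Ω) (X : ℤ → Ω → Fin d → ℝ) (n : ℕ) (δ μ : ℝ) (ω : Ω) : ℝ :=
  ⨆ q ∈ {q : (Fin d → ℝ) × (Fin d → ℝ) |
      q.1 ∈ Set.Icc 0 1 ∧ q.2 ∈ Set.Icc 0 1 ∧ dist q.1 q.2 ≤ δ},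
    |alphan P X n q.1 ω - alphan P X n q.2 ω| / max (dist q.1 q.2 ^ μ) ((n : ℝ) ^ (-μ))

/-- Condition 4.1 with parameter `θ₁`. -/
def Condition41 (P : Measure Ω) (X : ℤ → Ω → Fin d → ℝ) (θ₁ : ℝ) : Prop :=
  ∀ μ ∈ Set.Ioo (0 : ℝ) θ₁, ∀ δ : ℕ → ℝ, Tendsto δ atTop (nhds 0) →
    oP1 P (fun n ω => Mn P X n (δ n) μ ω)

/-- Condition 4.3 with parameters `θ₂, θ₃`. -/
def Condition43 (P : Measure Ω) (X : ℤ → Ω → Fin d → ℝ) (θ₂ θ₃ : ℝ) : Prop :=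
  ∀ w ∈ Set.Ioo (0 : ℝ) θ₂, ∀ lam ∈ Set.Ioo (0 : ℝ) θ₃, ∀ j : Fin d,
    bigOP P (fun n ω => ⨆ s ∈ Set.Ioo (0 : ℝ) 1,
      |alphanj P X n j s ω| / (s * (1 - s)) ^ w) ∧
    bigOP P (fun n ω => ⨆ s ∈ Set.Ioo ((n : ℝ) ^ (-lam)) (1 - (n : ℝ) ^ (-lam)),
      |betanj P X n j s ω| / (s * (1 - s)) ^ w)

/-- A value of a bounded nonnegative function on a set is at most its supremum there. -/
theorem le_biSup_of_nonneg {α : Type*} {S : Set α} {f : α → ℝ} {B : ℝ}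
    (h0 : ∀ s ∈ S, 0 ≤ f s) (hB : ∀ s ∈ S, f s ≤ B) {s : α} (hs : s ∈ S) :
    f s ≤ ⨆ t ∈ S, f t := by
  have hB0 : 0 ≤ B := (h0 s hs).trans (hB s hs)
  have hbdd : BddAbove (Set.range fun t => ⨆ _ : t ∈ S, f t) := by
    refine ⟨B, ?_⟩
    rintro _ ⟨t, rfl⟩
    exact Real.iSup_le (fun ht => hB t ht) hB0
  refine le_ciSup_of_le hbdd s ?_
  simp [hs]

theorem Uv_mem_Icc {Ω : Type*} [MeasurableSpace Ω] {d : ℕ} (P : Measure Ω)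
    [IsProbabilityMeasure P] (X : ℤ → Ω → Fin d → ℝ) (i : ℤ) (ω : Ω) (j : Fin d) :
    Uv P X i ω j ∈ Set.Icc (0 : ℝ) 1 :=
  ⟨measureReal_nonneg, measureReal_le_one⟩

theorem Gnj_of_neg {Ω : Type*} [MeasurableSpace Ω] {d : ℕ} (P : Measure Ω)
    [IsProbabilityMeasure P] (X : ℤ → Ω → Fin d → ℝ) (n : ℕ) (j : Fin d) {x : ℝ} (hx : x < 0)
    (ω : Ω) : Gnj P X n j x ω = 0 := by
  have h : ∀ i, ¬ Uv P X i ω j ≤ x := fun i => not_le.mpr (hx.trans_le (Uv_mem_Icc P X i ω j).1)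
  simp [Gnj, indic, h]

theorem Gnj_one {Ω : Type*} [MeasurableSpace Ω] {d : ℕ} (P : Measure Ω)
    [IsProbabilityMeasure P] (X : ℤ → Ω → Fin d → ℝ) {n : ℕ} (hn : n ≠ 0) (j : Fin d) (ω : Ω) :
    Gnj P X n j 1 ω = 1 := by
  have h : ∀ i, Uv P X i ω j ≤ 1 := fun i => (Uv_mem_Icc P X i ω j).2
  simp [Gnj, indic, h, hn]

theorem genInv_Gnj_mem_Icc {Ω : Type*} [MeasurableSpace Ω] {d : ℕ} (P : Measure Ω)
    [IsProbabilityMeasure P] (X : ℤ → Ω → Fin d → ℝ) {n : ℕ} (hn : n ≠ 0) (j : Fin d) (ω : Ω)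
    {s : ℝ} (hs : s ∈ Set.Ioo (0 : ℝ) 1) :
    genInv (fun x => Gnj P X n j x ω) s ∈ Set.Icc (0 : ℝ) 1 := by
  have hone : (1 : ℝ) ∈ {x | s ≤ Gnj P X n j x ω} := by
    simpa [Gnj_one P X hn j ω] using hs.2.le
  have hlow : ∀ x ∈ {x | s ≤ Gnj P X n j x ω}, (0 : ℝ) ≤ x := by
    intro x hx
    by_contra! hneg
    rw [Set.mem_ofPred_eq, Gnj_of_neg P X n j hneg] at hx
    exact absurd hs.1 (not_lt.mpr hx)
  rw [genInv, if_neg hs.1.ne']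
  exact ⟨le_csInf ⟨1, hone⟩ hlow, csInf_le ⟨0, hlow⟩ hone⟩

theorem half_le_mul_one_sub {a s : ℝ} (ha : 0 < a) (hs : s ∈ Set.Icc a (1 - a)) :
    a / 2 ≤ s * (1 - s) := by
  obtain ⟨h1, h2⟩ := hs
  rcases le_total s (1 / 2) with h | h <;> nlinarith

theorem abs_betanj_le {Ω : Type*} [MeasurableSpace Ω] {d : ℕ} (P : Measure Ω)
    [IsProbabilityMeasure P] (X : ℤ → Ω → Fin d → ℝ) {n : ℕ} (hn : n ≠ 0) (j : Fin d) (ω : Ω)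
    {s : ℝ} (hs : s ∈ Set.Ioo (0 : ℝ) 1) : |betanj P X n j s ω| ≤ Real.sqrt n := by
  have hg := genInv_Gnj_mem_Icc P X hn j ω hs
  rw [betanj, abs_mul, abs_of_nonneg (Real.sqrt_nonneg _)]
  refine mul_le_of_le_one_right (Real.sqrt_nonneg _) (abs_le.mpr ⟨?_, ?_⟩) <;>
    linarith [hg.1, hg.2, hs.1, hs.2]

/-- The weighted supremum of the quantile process is a genuine supremum. -/
theorem le_biSup_betanj {Ω : Type*} [MeasurableSpace Ω] {d : ℕ} (P : Measure Ω)
    [IsProbabilityMeasure P] (X : ℤ → Ω → Fin d → ℝ) {n : ℕ} (hn : n ≠ 0) (j : Fin d) (ω : Ω)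
    {w a s : ℝ} (hw : 0 ≤ w) (ha : 0 < a) (hs : s ∈ Set.Ioo a (1 - a)) :
    |betanj P X n j s ω| / (s * (1 - s)) ^ w ≤
      ⨆ t ∈ Set.Ioo a (1 - a), |betanj P X n j t ω| / (t * (1 - t)) ^ w := by
  refine le_biSup_of_nonneg (S := Set.Ioo a (1 - a)) (B := Real.sqrt n / (a / 2) ^ w)
    (f := fun t => |betanj P X n j t ω| / (t * (1 - t)) ^ w) ?_ ?_ hs
  · intro t ht
    have := half_le_mul_one_sub ha (Set.Ioo_subset_Icc_self ht)
    have : 0 < t * (1 - t) := by linarith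
    positivity
  · intro t ht
    have hv := half_le_mul_one_sub ha (Set.Ioo_subset_Icc_self ht)
    have hβ := abs_betanj_le P X hn j ω (s := t) ⟨ha.trans ht.1, by linarith [ht.2]⟩
    have hpow : (a / 2) ^ w ≤ (t * (1 - t)) ^ w := Real.rpow_le_rpow (by positivity) hv hw
    gcongr

/-- If `g` is within `s(1-s)/2` of `s`, every point `ξ` between them has
`s(1-s) ≤ 4ξ(1-ξ)`. -/
theorem abs_ratio_le_four {s g ξ : ℝ} (hs : s ∈ Set.Ioo (0 : ℝ) 1)
    (hg : |g - s| ≤ s * (1 - s) / 2) (hξ : ξ ∈ Set.uIcc g s) :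
    |s * (1 - s) / (ξ * (1 - ξ))| ≤ 4 := by
  obtain ⟨h0, h1⟩ := hs
  have hd : |ξ - s| ≤ s * (1 - s) / 2 := by
    refine le_trans ?_ hg
    have := Set.abs_sub_right_of_mem_uIcc hξ
    rwa [abs_sub_comm, abs_sub_comm s g] at this
  obtain ⟨hl, hu⟩ := abs_le.mp hd
  have hξ0 : s / 2 ≤ ξ := by nlinarith
  have hξ1 : (1 - s) / 2 ≤ 1 - ξ := by nlinarith
  have hprod : s / 2 * ((1 - s) / 2) ≤ ξ * (1 - ξ) :=
    mul_le_mul hξ0 hξ1 (by linarith) (by linarith)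
  have hpos : 0 < s * (1 - s) := mul_pos h0 (by linarith)
  have hξpos : 0 < ξ * (1 - ξ) := by linarith
  rw [abs_of_nonneg (by positivity), div_le_iff₀ hξpos]
  linarith

theorem eventually_mul_rpow_le_sqrt {M w γ : ℝ} (h : γ * (1 - w) < 1 / 2) :
    ∀ᶠ n : ℕ in atTop, M * ((n : ℝ) ^ (-γ) / 2) ^ (w - 1) ≤ Real.sqrt n / 2 := by
  have hlim : Tendsto (fun n : ℕ => M * 2 ^ (1 - w) * (n : ℝ) ^ (-(1 / 2 - γ * (1 - w))))
      atTop (nhds 0) := by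
    simpa using ((tendsto_rpow_neg_atTop (sub_pos.mpr h)).comp
      tendsto_natCast_atTop_atTop).const_mul (M * 2 ^ (1 - w))
  filter_upwards [hlim.eventually_le_const (show (0 : ℝ) < 1 / 2 by norm_num),
    eventually_gt_atTop 0] with n hn hn0
  have hpos : (0 : ℝ) < n := by exact_mod_cast hn0
  have hsplit : ((n : ℝ) ^ (-γ) / 2) ^ (w - 1) =
      2 ^ (1 - w) * (n : ℝ) ^ (-(1 / 2 - γ * (1 - w))) * Real.sqrt n := by
    rw [Real.div_rpow (by positivity) (by norm_num), ← Real.rpow_mul hpos.le,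
      Real.sqrt_eq_rpow, mul_assoc, ← Real.rpow_add hpos, div_eq_mul_inv,
      ← Real.rpow_neg (by norm_num), mul_comm]
    congr 2 <;> ring
  rw [hsplit]
  nlinarith [mul_le_mul_of_nonneg_right hn (Real.sqrt_nonneg n)]

/-- Lemma 6.2: under Condition 4.3, the ratio `s(1−s)/(ξ(1−ξ))` is bounded in
probability, uniformly over `s ∈ [n^{−γ}, 1−n^{−γ}]` and intermediate points `ξ`
between `G_{nj}⁻(s)` and `s`. -/
theorem intermediate_point_ratio_bounded
    {Ω : Type*} [MeasurableSpace Ω] {d : ℕ} (hd : 2 ≤ d)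
    (P : Measure Ω) [IsProbabilityMeasure P] (X : ℤ → Ω → Fin d → ℝ)
    (hmeas : ∀ i, Measurable (X i)) (hstat : StrictlyStationary P X)
    (hcont : ∀ j, Continuous (margF P X j))
    (θ₂ θ₃ : ℝ) (hθ₂ : θ₂ ∈ Set.Ioc (0 : ℝ) (1/2)) (hθ₃ : θ₃ ∈ Set.Ioc (1/2 : ℝ) 1)
    (h43 : Condition43 P X θ₂ θ₃) :
    ∀ j : Fin d, ∀ γ ∈ Set.Ioo (0 : ℝ) (min (1 / (2 * (1 - θ₂))) θ₃),
      bigOP P (fun n ω =>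
        ⨆ q ∈ {q : ℝ × ℝ | q.1 ∈ Set.Icc ((n : ℝ) ^ (-γ)) (1 - (n : ℝ) ^ (-γ)) ∧
            q.2 ∈ Set.uIcc (genInv (fun x => Gnj P X n j x ω) q.1) q.1},
          |q.1 * (1 - q.1) / (q.2 * (1 - q.2))|) := by
  intro j γ hγ ε hε
  obtain ⟨hγ0, hγlt⟩ := hγ
  obtain ⟨hγθ₂, hγθ₃⟩ := lt_min_iff.mp hγlt
  obtain ⟨w, ⟨hw0, hwθ⟩, hγw⟩ : ∃ w ∈ Set.Ioo (0 : ℝ) θ₂, γ * (1 - w) < 1 / 2 := by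
    have hpos : 0 < 2 * (1 - θ₂) := by linarith [hθ₂.2]
    rw [lt_div_iff₀ hpos] at hγθ₂
    obtain ⟨w, hw, hwθ⟩ := exists_between
      (show max 0 (1 - 1 / (2 * γ)) < θ₂ from max_lt hθ₂.1 (by
        rw [sub_lt_comm, lt_div_iff₀ (by positivity)]
        linarith))
    obtain ⟨hw0, hw1⟩ := max_lt_iff.mp hw
    refine ⟨w, ⟨hw0, hwθ⟩, ?_⟩
    rw [sub_lt_comm, lt_div_iff₀ (by positivity)] at hw1
    linarith
  obtain ⟨lam, hγlam, hlamθ⟩ := exists_between hγθ₃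
  obtain ⟨M, hM⟩ := (h43 w ⟨hw0, hwθ⟩ lam ⟨hγ0.trans hγlam, hlamθ⟩ j).2 ε hε
  refine ⟨4, ?_⟩
  filter_upwards [hM, eventually_mul_rpow_le_sqrt (M := M) hγw, eventually_gt_atTop 1]
    with n hMn hsqrt hn
  refine (measure_mono fun ω hω => ?_).trans hMn
  rw [Set.mem_ofPred_eq] at hω ⊢
  by_contra! hsup
  refine hω.not_ge ?_
  have hM0 : 0 ≤ M := (abs_nonneg _).trans hsup
  have hn1 : (1 : ℝ) < n := by exact_mod_cast hn
  have hn0 : (0 : ℝ) < n := by linarith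
  have hlam0 : 0 < (n : ℝ) ^ (-lam) := by positivity
  have ha0 : 0 < (n : ℝ) ^ (-γ) := by positivity
  have hlt : (n : ℝ) ^ (-lam) < (n : ℝ) ^ (-γ) :=
    Real.rpow_lt_rpow_of_exponent_lt hn1 (by linarith)
  rw [abs_of_nonneg (Real.iSup_nonneg fun _ => Real.iSup_nonneg fun _ => abs_nonneg _)]
  refine Real.iSup_le (fun ⟨s, ξ⟩ => Real.iSup_le (fun hq => ?_) (by norm_num)) (by norm_num)
  obtain ⟨hs, hξ⟩ := hq
  simp only at hs hξ ⊢
  have hs01 : s ∈ Set.Ioo (0 : ℝ) 1 := ⟨ha0.trans_le hs.1, by linarith [hs.2]⟩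
  refine abs_ratio_le_four hs01 ?_ hξ
  have hv := half_le_mul_one_sub ha0 hs
  have hv0 : 0 < s * (1 - s) := by linarith
  have hβ := (le_biSup_betanj P X (by omega) j ω hw0.le hlam0
    ⟨hlt.trans_le hs.1, by linarith [hs.2]⟩).trans ((le_abs_self _).trans hsup)
  rw [div_le_iff₀ (by positivity), betanj, abs_mul, abs_of_nonneg (Real.sqrt_nonneg _)] at hβ
  have hpow : (s * (1 - s)) ^ (w - 1) ≤ ((n : ℝ) ^ (-γ) / 2) ^ (w - 1) :=
    Real.rpow_le_rpow_of_nonpos (by positivity) hv (by linarith [hθ₂.2])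
  have hweight : M * (s * (1 - s)) ^ w ≤ Real.sqrt n * (s * (1 - s) / 2) := by
    have hsplit : (s * (1 - s)) ^ w = (s * (1 - s)) ^ (w - 1) * (s * (1 - s)) := by
      rw [← Real.rpow_add_one hv0.ne', sub_add_cancel]
    calc M * (s * (1 - s)) ^ w = M * (s * (1 - s)) ^ (w - 1) * (s * (1 - s)) := by
          rw [hsplit, mul_assoc]
      _ ≤ Real.sqrt n / 2 * (s * (1 - s)) := by
          gcongr
          exact (mul_le_mul_of_nonneg_left hpow hM0).trans hsqrt
      _ = Real.sqrt n * (s * (1 - s) / 2) := by ring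
  exact le_of_mul_le_mul_left (hβ.trans hweight) (Real.sqrt_pos.mpr hn0)

end BBV
end
end

section
/- Let [a,b] ⊂ ℝ² be a compact rectangle, let μ, ν be finite signed Borel measures on [a,b], and put f(x) = μ([a,x]), g(x) = ν([a,x]) for x ∈ [a,b]. Then for every half-open rectangle (c,d] ⊆ [a,b] with c < d: ∫_{(c,d]} f dν = ∫_{(c,d]} g dμ + Δ(fg, c₁,c₂,d₁,d₂) − ∫_{(c₁,d₁]} g(u,d₂) f(du,d₂) + ∫_{(c₁,d₁]} g(u,c₂) f(du,c₂) − ∫_{(c₂,d₂]} g(d₁,v) f(d₁,dv) + ∫_{(c₂,d₂]} g(c₁,v) f(c₁,dv) + ∫_{(c,d]} [ ν({u}×(v,d₂]) + ν((u,d₁]×{v}) + ν({(u,v)}) ] dμ(u,v) + ∫_{(c₁,d₁]} ν({u}×(c₂,d₂]) f(du,c₂) + ∫_{(c₂,d₂]} ν((c₁,d₁]×{v}) f(c₁,dv). -/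
open MeasureTheory Set

noncomputable section

namespace BBV

/-- Integral of a function with respect to a finite signed measure, defined through
the Jordan decomposition: `∫ h dλ = ∫ h dλ⁺ − ∫ h dλ⁻`. -/
def sInt {α : Type*} [MeasurableSpace α] (lam : SignedMeasure α) (h : α → ℝ) : ℝ :=
  (∫ x, h x ∂lam.toJordanDecomposition.posPart) - ∫ x, h x ∂lam.toJordanDecomposition.negPart

/-- Integral of `h` over the set `s` with respect to the finite signed measure `lam`. -/
def sIntOn {α : Type*} [MeasurableSpace α] (lam : SignedMeasure α) (s : Set α) (h : α → ℝ) : ℝ :=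
  sInt lam (s.indicator h)

/-- The "c.d.f." `x ↦ μ([a,x])` of a signed measure on a rectangle anchored at `a`. -/
def cdf2 (μ : SignedMeasure (ℝ × ℝ)) (a : ℝ × ℝ) (x : ℝ × ℝ) : ℝ :=
  μ (Icc a.1 x.1 ×ˢ Icc a.2 x.2)

/-- The first-coordinate slice measure `f(du, y) : A ↦ μ(A × [a₂, y])`. -/
def slice1 (μ : SignedMeasure (ℝ × ℝ)) (a : ℝ × ℝ) (y : ℝ) : SignedMeasure ℝ :=
  (μ.restrict (Set.univ ×ˢ Icc a.2 y)).map Prod.fst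

/-- The second-coordinate slice measure `f(x, dv) : B ↦ μ([a₁, x] × B)`. -/
def slice2 (μ : SignedMeasure (ℝ × ℝ)) (a : ℝ × ℝ) (x : ℝ) : SignedMeasure ℝ :=
  (μ.restrict (Icc a.1 x ×ˢ Set.univ)).map Prod.snd

/-- The rectangular increment `Δ(h, c₁, c₂, d₁, d₂)`. -/
def Δ4 (h : ℝ × ℝ → ℝ) (c₁ c₂ d₁ d₂ : ℝ) : ℝ :=
  h (d₁, d₂) - h (c₁, d₂) - h (d₁, c₂) + h (c₁, c₂)

/-- A finite signed Borel measure "lives on" the rectangle `[a,b]`. -/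
def LivesOn (μ : SignedMeasure (ℝ × ℝ)) (a b : ℝ × ℝ) : Prop :=
  ∀ s : Set (ℝ × ℝ), MeasurableSet s → μ s = μ (s ∩ (Icc a.1 b.1 ×ˢ Icc a.2 b.2))

section SignedPairing

variable {α β : Type*} [MeasurableSpace α] [MeasurableSpace β]

lemma sInt_eq_integral_sub_integral {lam : SignedMeasure α} {m₁ m₂ : Measure α}
    [IsFiniteMeasure m₁] [IsFiniteMeasure m₂] (h : lam = m₁.toSignedMeasure - m₂.toSignedMeasure)
    {f : α → ℝ} (hf : Measurable f) {C : ℝ} (hC : ∀ x, |f x| ≤ C) :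
    sInt lam f = ∫ x, f x ∂m₁ - ∫ x, f x ∂m₂ := by
  have hint : ∀ m : Measure α, IsFiniteMeasure m → Integrable f m := fun m _ =>
    Integrable.of_bound hf.aestronglyMeasurable C (ae_of_all _ hC)
  set j := lam.toJordanDecomposition with hj
  have hjl : j.posPart.toSignedMeasure - j.negPart.toSignedMeasure = lam :=
    lam.toSignedMeasure_toJordanDecomposition
  have hadd : j.posPart + m₂ = m₁ + j.negPart := by
    rw [← Measure.toSignedMeasure_eq_toSignedMeasure_iff, Measure.toSignedMeasure_add,
      Measure.toSignedMeasure_add]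
    rw [← hjl] at h
    exact sub_eq_sub_iff_add_eq_add.1 h
  have hI := congrArg (fun m => ∫ x, f x ∂m) hadd
  rw [integral_add_measure (hint _ inferInstance) (hint _ inferInstance),
    integral_add_measure (hint _ inferInstance) (hint _ inferInstance)] at hI
  rw [sInt, ← hj]
  linarith

lemma sInt_restrict_map (μ : SignedMeasure α) {A : Set α} (hA : MeasurableSet A) {φ : α → β}
    (hφ : Measurable φ) {f : β → ℝ} (hf : Measurable f) {C : ℝ} (hC : ∀ x, |f x| ≤ C) :
    sInt ((μ.restrict A).map φ) f = sIntOn μ A (f ∘ φ) := by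
  have key : (μ.restrict A).map φ =
      ((μ.toJordanDecomposition.posPart.restrict A).map φ).toSignedMeasure -
        ((μ.toJordanDecomposition.negPart.restrict A).map φ).toSignedMeasure := by
    ext s hs
    rw [Measure.toSignedMeasure_sub_apply hs, VectorMeasure.map_apply _ hφ hs,
      VectorMeasure.restrict_apply _ hA (hφ hs),
      μ.apply_eq_posPart_real_sub_negPart_real ((hφ hs).inter hA),
      map_measureReal_apply hφ hs, map_measureReal_apply hφ hs,
      measureReal_restrict_apply (hφ hs), measureReal_restrict_apply (hφ hs)]
  rw [sInt_eq_integral_sub_integral key hf hC, integral_map hφ.aemeasurable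
    hf.aestronglyMeasurable, integral_map hφ.aemeasurable hf.aestronglyMeasurable, sIntOn, sInt,
    integral_indicator hA, integral_indicator hA]
  rfl

/-- The value on `S` of the product of the signed measures `μ` and `ν`. -/
def prodApply (μ : SignedMeasure α) (ν : SignedMeasure β) (S : Set (α × β)) : ℝ :=
  (μ.toJordanDecomposition.posPart.prod ν.toJordanDecomposition.posPart).real S
    - (μ.toJordanDecomposition.posPart.prod ν.toJordanDecomposition.negPart).real S
    - ((μ.toJordanDecomposition.negPart.prod ν.toJordanDecomposition.posPart).real S
    - (μ.toJordanDecomposition.negPart.prod ν.toJordanDecomposition.negPart).real S)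

lemma integral_real_prodMk_preimage (m : Measure α) (n : Measure β) [IsFiniteMeasure m]
    [IsFiniteMeasure n] {S : Set (α × β)} (hS : MeasurableSet S) :
    ∫ x, n.real (Prod.mk x ⁻¹' S) ∂m = (m.prod n).real S := by
  simp only [measureReal_def]
  rw [integral_toReal (measurable_measure_prodMk_left hS).aemeasurable
    (ae_of_all _ fun _ => measure_lt_top _ _), Measure.prod_apply hS]

lemma apply_prodMk_preimage (ν : SignedMeasure β) {S : Set (α × β)} (hS : MeasurableSet S)
    (x : α) : ν (Prod.mk x ⁻¹' S) =
      ν.toJordanDecomposition.posPart.real (Prod.mk x ⁻¹' S)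
        - ν.toJordanDecomposition.negPart.real (Prod.mk x ⁻¹' S) :=
  ν.apply_eq_posPart_real_sub_negPart_real (measurable_prodMk_left hS)

lemma measurable_apply_prodMk_preimage (ν : SignedMeasure β) {S : Set (α × β)}
    (hS : MeasurableSet S) : Measurable fun x => ν (Prod.mk x ⁻¹' S) := by
  simp only [apply_prodMk_preimage ν hS]
  exact (measurable_measure_prodMk_left hS).ennreal_toReal.sub
    (measurable_measure_prodMk_left hS).ennreal_toReal

lemma abs_apply_le (ν : SignedMeasure β) {S : Set β} (hS : MeasurableSet S) :
    |ν S| ≤ ν.toJordanDecomposition.posPart.real univ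
      + ν.toJordanDecomposition.negPart.real univ := by
  rw [ν.apply_eq_posPart_real_sub_negPart_real hS]
  have h₁ := measureReal_mono (μ := ν.toJordanDecomposition.posPart) (subset_univ S)
  have h₂ := measureReal_mono (μ := ν.toJordanDecomposition.negPart) (subset_univ S)
  have h₃ := measureReal_nonneg (μ := ν.toJordanDecomposition.posPart) (s := S)
  have h₄ := measureReal_nonneg (μ := ν.toJordanDecomposition.negPart) (s := S)
  rw [abs_le]
  constructor <;> linarith

lemma integrable_apply_prodMk_preimage (m : Measure α) [IsFiniteMeasure m] (ν : SignedMeasure β)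
    {S : Set (α × β)} (hS : MeasurableSet S) : Integrable (fun x => ν (Prod.mk x ⁻¹' S)) m :=
  Integrable.of_bound (measurable_apply_prodMk_preimage ν hS).aestronglyMeasurable _
    (ae_of_all _ fun _ => abs_apply_le ν (measurable_prodMk_left hS))

lemma sInt_apply_prodMk_preimage (μ : SignedMeasure α) (ν : SignedMeasure β) {S : Set (α × β)}
    (hS : MeasurableSet S) : sInt μ (fun x => ν (Prod.mk x ⁻¹' S)) = prodApply μ ν S := by
  have hi : ∀ (m : Measure α) (n : Measure β), IsFiniteMeasure m → IsFiniteMeasure n →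
      Integrable (fun x => n.real (Prod.mk x ⁻¹' S)) m := fun m n _ _ =>
    Measure.integrable_measure_prodMk_left hS (measure_ne_top _ _)
  simp only [sInt, prodApply, apply_prodMk_preimage ν hS]
  rw [integral_sub (hi _ _ inferInstance inferInstance) (hi _ _ inferInstance inferInstance),
    integral_sub (hi _ _ inferInstance inferInstance) (hi _ _ inferInstance inferInstance)]
  simp only [integral_real_prodMk_preimage _ _ hS]

omit [MeasurableSpace α] in
lemma indicator_apply_eq_apply_prodMk_preimage (ν : SignedMeasure β) (s : Set α)
    (T : α → Set β) :
    s.indicator (fun x => ν (T x)) =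
      fun x => ν (Prod.mk x ⁻¹' {z : α × β | z.1 ∈ s ∧ z.2 ∈ T z.1}) := by
  ext x
  by_cases hx : x ∈ s <;> simp [hx]

lemma sIntOn_apply (μ : SignedMeasure α) (ν : SignedMeasure β) {s : Set α} {T : α → Set β}
    {S : Set (α × β)} (hS : MeasurableSet S) (h : ∀ x y, (x, y) ∈ S ↔ x ∈ s ∧ y ∈ T x) :
    sIntOn μ s (fun x => ν (T x)) = prodApply μ ν S := by
  obtain rfl : S = {z : α × β | z.1 ∈ s ∧ z.2 ∈ T z.1} := by
    ext ⟨x, y⟩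
    exact h x y
  rw [sIntOn, indicator_apply_eq_apply_prodMk_preimage, sInt_apply_prodMk_preimage μ ν hS]

lemma sIntOn_apply_add₃ (μ : SignedMeasure α) (ν : SignedMeasure β) {s : Set α}
    {T₁ T₂ T₃ : α → Set β} {S₁ S₂ S₃ : Set (α × β)}
    (hS₁ : MeasurableSet S₁) (h₁ : ∀ x y, (x, y) ∈ S₁ ↔ x ∈ s ∧ y ∈ T₁ x)
    (hS₂ : MeasurableSet S₂) (h₂ : ∀ x y, (x, y) ∈ S₂ ↔ x ∈ s ∧ y ∈ T₂ x)
    (hS₃ : MeasurableSet S₃) (h₃ : ∀ x y, (x, y) ∈ S₃ ↔ x ∈ s ∧ y ∈ T₃ x) :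
    sIntOn μ s (fun x => ν (T₁ x) + ν (T₂ x) + ν (T₃ x)) =
      prodApply μ ν S₁ + prodApply μ ν S₂ + prodApply μ ν S₃ := by
  have hi : ∀ (m : Measure α), IsFiniteMeasure m → ∀ {T : α → Set β} {S : Set (α × β)},
      MeasurableSet S → (∀ x y, (x, y) ∈ S ↔ x ∈ s ∧ y ∈ T x) →
      Integrable (s.indicator fun x => ν (T x)) m := by
    intro m _ T S hS h
    obtain rfl : S = {z : α × β | z.1 ∈ s ∧ z.2 ∈ T z.1} := by
      ext ⟨x, y⟩
      exact h x y
    rw [indicator_apply_eq_apply_prodMk_preimage]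
    exact integrable_apply_prodMk_preimage m ν hS
  have hsum : s.indicator (fun x => ν (T₁ x) + ν (T₂ x) + ν (T₃ x)) =
      fun x => s.indicator (fun x => ν (T₁ x)) x + s.indicator (fun x => ν (T₂ x)) x
        + s.indicator (fun x => ν (T₃ x)) x := by
    ext x
    by_cases hx : x ∈ s <;> simp [hx]
  have hI : ∀ m : Measure α, IsFiniteMeasure m →
      ∫ x, s.indicator (fun x => ν (T₁ x) + ν (T₂ x) + ν (T₃ x)) x ∂m =
        (∫ x, s.indicator (fun x => ν (T₁ x)) x ∂m) + (∫ x, s.indicator (fun x => ν (T₂ x)) x ∂m)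
          + ∫ x, s.indicator (fun x => ν (T₃ x)) x ∂m := by
    intro m hm
    have h₁₂ := integral_add (hi m hm hS₁ h₁) (hi m hm hS₂ h₂)
    rw [hsum, ← h₁₂]
    exact integral_add ((hi m hm hS₁ h₁).add (hi m hm hS₂ h₂)) (hi m hm hS₃ h₃)
  rw [← sIntOn_apply μ ν hS₁ h₁, ← sIntOn_apply μ ν hS₂ h₂, ← sIntOn_apply μ ν hS₃ h₃]
  simp only [sIntOn, sInt]
  rw [hI _ inferInstance, hI _ inferInstance]
  ring

lemma prodApply_swap (μ : SignedMeasure α) (ν : SignedMeasure β) {S : Set (α × β)}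
    (hS : MeasurableSet S) : prodApply ν μ (Prod.swap ⁻¹' S) = prodApply μ ν S := by
  have h : ∀ (m : Measure α) (n : Measure β), IsFiniteMeasure m → IsFiniteMeasure n →
      (n.prod m).real (Prod.swap ⁻¹' S) = (m.prod n).real S := fun m n _ _ => by
    rw [← map_measureReal_apply measurable_swap hS, Measure.prod_swap]
  simp only [prodApply]
  rw [h _ _ inferInstance inferInstance, h _ _ inferInstance inferInstance,
    h _ _ inferInstance inferInstance, h _ _ inferInstance inferInstance]
  ring

lemma prodApply_prod (μ : SignedMeasure α) (ν : SignedMeasure β) {s : Set α} {t : Set β}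
    (hs : MeasurableSet s) (ht : MeasurableSet t) : prodApply μ ν (s ×ˢ t) = μ s * ν t := by
  simp only [prodApply, measureReal_prod_prod, μ.apply_eq_posPart_real_sub_negPart_real hs,
    ν.apply_eq_posPart_real_sub_negPart_real ht]
  ring

lemma sum_mul_prodApply_eq_zero (μ : SignedMeasure α) (ν : SignedMeasure β) {ι : Type*}
    [Fintype ι] (w : ι → ℝ) {S : ι → Set (α × β)} (hS : ∀ i, MeasurableSet (S i))
    (h : ∀ z, ∑ i, w i * (S i).indicator 1 z = 0) : ∑ i, w i * prodApply μ ν (S i) = 0 := by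
  have key : ∀ m : Measure (α × β), IsFiniteMeasure m → ∑ i, w i * m.real (S i) = 0 := by
    intro m _
    have hI : ∫ z, ∑ i, w i * (S i).indicator (1 : α × β → ℝ) z ∂m = ∑ i, w i * m.real (S i) := by
      rw [integral_finsetSum]
      · refine Finset.sum_congr rfl fun i _ => ?_
        rw [integral_const_mul, integral_indicator_one (hS i)]
      · intro i _
        exact ((integrable_const (1 : ℝ)).indicator (hS i)).const_mul _
    rw [← hI]
    simp [h]
  simp only [prodApply, mul_sub, Finset.sum_sub_distrib]
  rw [key _ inferInstance, key _ inferInstance, key _ inferInstance, key _ inferInstance]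
  simp

end SignedPairing

lemma sIntOn_slice1_apply (μ ν : SignedMeasure (ℝ × ℝ)) (a : ℝ × ℝ) (y : ℝ) {s : Set ℝ}
    {T : ℝ → Set (ℝ × ℝ)} (hT : MeasurableSet {z : ℝ × ℝ × ℝ | z.1 ∈ s ∧ z.2 ∈ T z.1})
    {S : Set ((ℝ × ℝ) × ℝ × ℝ)} (hS : MeasurableSet S)
    (h : ∀ x y', (x, y') ∈ S ↔ x ∈ s ×ˢ Icc a.2 y ∧ y' ∈ T x.1) :
    sIntOn (slice1 μ a y) s (fun u => ν (T u)) = prodApply μ ν S := by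
  rw [sIntOn, indicator_apply_eq_apply_prodMk_preimage, slice1,
    sInt_restrict_map μ (MeasurableSet.univ.prod measurableSet_Icc) measurable_fst
      (measurable_apply_prodMk_preimage ν hT)
      fun _ => abs_apply_le ν (measurable_prodMk_left hT)]
  refine sIntOn_apply μ ν hS fun x y' => ?_
  rw [h]
  simp
  tauto

lemma sIntOn_slice2_apply (μ ν : SignedMeasure (ℝ × ℝ)) (a : ℝ × ℝ) (x : ℝ) {s : Set ℝ}
    {T : ℝ → Set (ℝ × ℝ)} (hT : MeasurableSet {z : ℝ × ℝ × ℝ | z.1 ∈ s ∧ z.2 ∈ T z.1})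
    {S : Set ((ℝ × ℝ) × ℝ × ℝ)} (hS : MeasurableSet S)
    (h : ∀ x' y, (x', y) ∈ S ↔ x' ∈ Icc a.1 x ×ˢ s ∧ y ∈ T x'.2) :
    sIntOn (slice2 μ a x) s (fun v => ν (T v)) = prodApply μ ν S := by
  rw [sIntOn, indicator_apply_eq_apply_prodMk_preimage, slice2,
    sInt_restrict_map μ (measurableSet_Icc.prod MeasurableSet.univ) measurable_snd
      (measurable_apply_prodMk_preimage ν hT)
      fun _ => abs_apply_le ν (measurable_prodMk_left hT)]
  refine sIntOn_apply μ ν hS fun x y' => ?_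
  rw [h]
  simp
  tauto

/-- The pairs of points whose first coordinates are related by `R` and whose second coordinates
are related by `R'`. -/
def coordRel (R R' : Set (ℝ × ℝ)) : Set ((ℝ × ℝ) × ℝ × ℝ) :=
  {z | (z.1.1, z.2.1) ∈ R ∧ (z.1.2, z.2.2) ∈ R'}

lemma measurableSet_coordRel {R R' : Set (ℝ × ℝ)} (hR : MeasurableSet R)
    (hR' : MeasurableSet R') : MeasurableSet (coordRel R R') := by
  have h₁ : Measurable fun z : (ℝ × ℝ) × ℝ × ℝ => (z.1.1, z.2.1) := by fun_prop
  have h₂ : Measurable fun z : (ℝ × ℝ) × ℝ × ℝ => (z.1.2, z.2.2) := by fun_prop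
  exact (h₁ hR).inter (h₂ hR')

lemma indicator_coordRel (R R' : Set (ℝ × ℝ)) (z : (ℝ × ℝ) × ℝ × ℝ) :
    (coordRel R R').indicator (1 : (ℝ × ℝ) × ℝ × ℝ → ℝ) z =
      R.indicator 1 (z.1.1, z.2.1) * R'.indicator 1 (z.1.2, z.2.2) := by
  by_cases h : (z.1.1, z.2.1) ∈ R <;> by_cases h' : (z.1.2, z.2.2) ∈ R' <;>
    simp [coordRel, h, h']

/-- Pairs `(p, q)` with `a ≤ p ≤ q` and `q ∈ (c, d]`. -/
def leRel (a c d : ℝ) : Set (ℝ × ℝ) := {r | a ≤ r.1 ∧ r.1 ≤ r.2 ∧ c < r.2 ∧ r.2 ≤ d}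

/-- Pairs `(p, q)` with `a ≤ q ≤ p` and `p ∈ (c, d]`. -/
def geRel (a c d : ℝ) : Set (ℝ × ℝ) := {r | a ≤ r.2 ∧ r.2 ≤ r.1 ∧ c < r.1 ∧ r.1 ≤ d}

/-- Pairs `(p, q)` with `p = q ∈ (c, d]`. -/
def diagRel (c d : ℝ) : Set (ℝ × ℝ) := {r | r.2 = r.1 ∧ c < r.1 ∧ r.1 ≤ d}

/-- Pairs `(p, q)` with `c < p < q ≤ d`. -/
def ltRel (c d : ℝ) : Set (ℝ × ℝ) := {r | c < r.1 ∧ r.1 < r.2 ∧ r.2 ≤ d}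

lemma measurableSet_leRel (a c d : ℝ) : MeasurableSet (leRel a c d) :=
  (measurableSet_le measurable_const measurable_fst).inter <|
    (measurableSet_le measurable_fst measurable_snd).inter <|
      (measurableSet_lt measurable_const measurable_snd).inter
        (measurableSet_le measurable_snd measurable_const)

lemma measurableSet_geRel (a c d : ℝ) : MeasurableSet (geRel a c d) :=
  (measurableSet_le measurable_const measurable_snd).inter <|
    (measurableSet_le measurable_snd measurable_fst).inter <|
      (measurableSet_lt measurable_const measurable_fst).inter
        (measurableSet_le measurable_fst measurable_const)

lemma measurableSet_diagRel (c d : ℝ) : MeasurableSet (diagRel c d) :=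
  (measurableSet_eq_fun measurable_snd measurable_fst).inter <|
      (measurableSet_lt measurable_const measurable_fst).inter
        (measurableSet_le measurable_fst measurable_const)

lemma measurableSet_ltRel (c d : ℝ) : MeasurableSet (ltRel c d) :=
  (measurableSet_lt measurable_const measurable_fst).inter <|
    (measurableSet_lt measurable_fst measurable_snd).inter
      (measurableSet_le measurable_snd measurable_const)

lemma indicator_Icc_prod_sub {a c d : ℝ} (hac : a ≤ c) (hcd : c < d) (r : ℝ × ℝ) :
    (Icc a d ×ˢ Icc a d).indicator (1 : ℝ × ℝ → ℝ) r - (Icc a c ×ˢ Icc a c).indicator 1 r =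
      (geRel a c d).indicator 1 r + (leRel a c d).indicator 1 r
        - (diagRel c d).indicator 1 r := by
  classical
  obtain ⟨p, q⟩ := r
  simp only [Set.indicator_apply, geRel, leRel, diagRel, mem_prod, mem_Icc, mem_ofPred_eq,
    Pi.one_apply]
  grind

lemma indicator_leRel {a c d : ℝ} (hac : a ≤ c) (r : ℝ × ℝ) :
    (leRel a c d).indicator (1 : ℝ × ℝ → ℝ) r = (diagRel c d).indicator 1 r
      + (ltRel c d).indicator 1 r + (Icc a c ×ˢ Ioc c d).indicator 1 r := by
  classical
  obtain ⟨p, q⟩ := r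
  simp only [Set.indicator_apply, ltRel, leRel, diagRel, mem_prod, mem_Icc, mem_Ioc, mem_ofPred_eq,
    Pi.one_apply]
  grind

lemma cdf2_mul_cdf2 (μ ν : SignedMeasure (ℝ × ℝ)) (a x : ℝ × ℝ) :
    cdf2 μ a x * cdf2 ν a x =
      prodApply μ ν (coordRel (Icc a.1 x.1 ×ˢ Icc a.1 x.1) (Icc a.2 x.2 ×ˢ Icc a.2 x.2)) := by
  have h : coordRel (Icc a.1 x.1 ×ˢ Icc a.1 x.1) (Icc a.2 x.2 ×ˢ Icc a.2 x.2) =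
      (Icc a.1 x.1 ×ˢ Icc a.2 x.2) ×ˢ (Icc a.1 x.1 ×ˢ Icc a.2 x.2) := by
    ext z
    simp only [coordRel, mem_prod, mem_ofPred_eq]
    tauto
  rw [h, prodApply_prod μ ν (measurableSet_Icc.prod measurableSet_Icc)
    (measurableSet_Icc.prod measurableSet_Icc), cdf2, cdf2]

/-- Theorem A.6 (integration by parts for two-variate Lebesgue–Stieltjes integrals),
general form, with correction terms accounting for atoms. -/
theorem integration_by_parts_two_dimensional
    (a b : ℝ × ℝ) (hab : a.1 ≤ b.1 ∧ a.2 ≤ b.2)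
    (μ ν : SignedMeasure (ℝ × ℝ)) (hμ : LivesOn μ a b) (hν : LivesOn ν a b)
    (c d : ℝ × ℝ) (hcd : c.1 < d.1 ∧ c.2 < d.2)
    (hac : a.1 ≤ c.1 ∧ a.2 ≤ c.2) (hdb : d.1 ≤ b.1 ∧ d.2 ≤ b.2) :
    sIntOn ν (Ioc c.1 d.1 ×ˢ Ioc c.2 d.2) (cdf2 μ a) =
      sIntOn μ (Ioc c.1 d.1 ×ˢ Ioc c.2 d.2) (cdf2 ν a)
        + Δ4 (fun x => cdf2 μ a x * cdf2 ν a x) c.1 c.2 d.1 d.2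
        - sIntOn (slice1 μ a d.2) (Ioc c.1 d.1) (fun u => cdf2 ν a (u, d.2))
        + sIntOn (slice1 μ a c.2) (Ioc c.1 d.1) (fun u => cdf2 ν a (u, c.2))
        - sIntOn (slice2 μ a d.1) (Ioc c.2 d.2) (fun v => cdf2 ν a (d.1, v))
        + sIntOn (slice2 μ a c.1) (Ioc c.2 d.2) (fun v => cdf2 ν a (c.1, v))
        + sIntOn μ (Ioc c.1 d.1 ×ˢ Ioc c.2 d.2)
            (fun p => ν ({p.1} ×ˢ Ioc p.2 d.2) + ν (Ioc p.1 d.1 ×ˢ {p.2}) + ν {p})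
        + sIntOn (slice1 μ a c.2) (Ioc c.1 d.1) (fun u => ν ({u} ×ˢ Ioc c.2 d.2))
        + sIntOn (slice2 μ a c.1) (Ioc c.2 d.2) (fun v => ν (Ioc c.1 d.1 ×ˢ {v})) := by
  obtain ⟨a₁, a₂⟩ := a
  obtain ⟨c₁, c₂⟩ := c
  obtain ⟨d₁, d₂⟩ := d
  obtain ⟨hac₁, hac₂⟩ := hac
  obtain ⟨hcd₁, hcd₂⟩ := hcd
  simp only at hac₁ hac₂ hcd₁ hcd₂
  have hN : ∀ a x : ℝ, MeasurableSet (Icc a x ×ˢ Icc a x) := fun _ _ =>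
    measurableSet_Icc.prod measurableSet_Icc
  have hV : ∀ a c d : ℝ, MeasurableSet (Icc a c ×ˢ Ioc c d) := fun _ _ _ =>
    measurableSet_Icc.prod measurableSet_Ioc
  have hX := measurableSet_geRel
  have hY := measurableSet_leRel
  have hZ := measurableSet_diagRel
  have hW := measurableSet_ltRel
  have hfst : Measurable fun z : ℝ × ℝ × ℝ => (z.1, z.2.1) := by fun_prop
  have hsnd : Measurable fun z : ℝ × ℝ × ℝ => (z.1, z.2.2) := by fun_prop
  have e₀ : sIntOn ν (Ioc c₁ d₁ ×ˢ Ioc c₂ d₂) (cdf2 μ (a₁, a₂)) =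
      prodApply μ ν (coordRel (leRel a₁ c₁ d₁) (leRel a₂ c₂ d₂)) := by
    rw [← prodApply_swap μ ν (measurableSet_coordRel (hY _ _ _) (hY _ _ _))]
    refine sIntOn_apply ν μ
      (measurable_swap (measurableSet_coordRel (hY _ _ _) (hY _ _ _))) ?_
    rintro ⟨q₁, q₂⟩ ⟨p₁, p₂⟩
    simp only [coordRel, leRel, mem_preimage, Prod.swap_prod_mk, mem_ofPred_eq, mem_prod, mem_Icc,
      mem_Ioc]
    tauto
  have e₁ : sIntOn μ (Ioc c₁ d₁ ×ˢ Ioc c₂ d₂) (cdf2 ν (a₁, a₂)) =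
      prodApply μ ν (coordRel (geRel a₁ c₁ d₁) (geRel a₂ c₂ d₂)) := by
    refine sIntOn_apply μ ν (measurableSet_coordRel (hX _ _ _) (hX _ _ _)) ?_
    rintro ⟨p₁, p₂⟩ ⟨q₁, q₂⟩
    simp only [coordRel, geRel, mem_ofPred_eq, mem_prod, mem_Icc, mem_Ioc]
    tauto
  have e₃ : ∀ y, sIntOn (slice1 μ (a₁, a₂) y) (Ioc c₁ d₁) (fun u => cdf2 ν (a₁, a₂) (u, y)) =
      prodApply μ ν (coordRel (geRel a₁ c₁ d₁) (Icc a₂ y ×ˢ Icc a₂ y)) := by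
    intro y
    refine sIntOn_slice1_apply μ ν _ _ ?_ (measurableSet_coordRel (hX _ _ _) (hN _ _)) ?_
    · convert! (hfst (hX a₁ c₁ d₁)).inter
        (measurable_snd.snd (measurableSet_Icc (a := a₂) (b := y))) using 1
      ext ⟨u, q₁, q₂⟩
      simp only [geRel, mem_ofPred_eq, mem_prod, mem_Icc, mem_Ioc, mem_inter_iff, mem_preimage]
      tauto
    · rintro ⟨p₁, p₂⟩ ⟨q₁, q₂⟩
      simp only [coordRel, geRel, mem_ofPred_eq, mem_prod, mem_Icc, mem_Ioc]
      tauto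
  have e₅ : ∀ x, sIntOn (slice2 μ (a₁, a₂) x) (Ioc c₂ d₂) (fun v => cdf2 ν (a₁, a₂) (x, v)) =
      prodApply μ ν (coordRel (Icc a₁ x ×ˢ Icc a₁ x) (geRel a₂ c₂ d₂)) := by
    intro x
    refine sIntOn_slice2_apply μ ν _ _ ?_ (measurableSet_coordRel (hN _ _) (hX _ _ _)) ?_
    · convert! (hsnd (hX a₂ c₂ d₂)).inter
        (measurable_snd.fst (measurableSet_Icc (a := a₁) (b := x))) using 1
      ext ⟨u, q₁, q₂⟩
      simp only [geRel, mem_ofPred_eq, mem_prod, mem_Icc, mem_Ioc, mem_inter_iff, mem_preimage]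
      tauto
    · rintro ⟨p₁, p₂⟩ ⟨q₁, q₂⟩
      simp only [coordRel, geRel, mem_ofPred_eq, mem_prod, mem_Icc, mem_Ioc]
      tauto
  have e₇ : sIntOn μ (Ioc c₁ d₁ ×ˢ Ioc c₂ d₂)
      (fun p => ν ({p.1} ×ˢ Ioc p.2 d₂) + ν (Ioc p.1 d₁ ×ˢ {p.2}) + ν {p}) =
      prodApply μ ν (coordRel (diagRel c₁ d₁) (ltRel c₂ d₂))
        + prodApply μ ν (coordRel (ltRel c₁ d₁) (diagRel c₂ d₂))
        + prodApply μ ν (coordRel (diagRel c₁ d₁) (diagRel c₂ d₂)) := by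
    refine sIntOn_apply_add₃ μ ν (measurableSet_coordRel (hZ _ _) (hW _ _)) ?_
      (measurableSet_coordRel (hW _ _) (hZ _ _)) ?_
      (measurableSet_coordRel (hZ _ _) (hZ _ _)) ?_ <;>
    · rintro ⟨p₁, p₂⟩ ⟨q₁, q₂⟩
      simp only [coordRel, diagRel, ltRel, mem_ofPred_eq, mem_prod, mem_Ioc, mem_singleton_iff,
        Prod.mk.injEq]
      grind
  have e₈ : sIntOn (slice1 μ (a₁, a₂) c₂) (Ioc c₁ d₁) (fun u => ν ({u} ×ˢ Ioc c₂ d₂)) =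
      prodApply μ ν (coordRel (diagRel c₁ d₁) (Icc a₂ c₂ ×ˢ Ioc c₂ d₂)) := by
    refine sIntOn_slice1_apply μ ν _ _ ?_ (measurableSet_coordRel (hZ _ _) (hV _ _ _)) ?_
    · convert! (hfst (hZ c₁ d₁)).inter
        (measurable_snd.snd (measurableSet_Ioc (a := c₂) (b := d₂))) using 1
      ext ⟨u, q₁, q₂⟩
      simp only [diagRel, mem_ofPred_eq, mem_prod, mem_Ioc, mem_inter_iff, mem_preimage,
        mem_singleton_iff]
      tauto
    · rintro ⟨p₁, p₂⟩ ⟨q₁, q₂⟩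
      simp only [coordRel, diagRel, mem_ofPred_eq, mem_prod, mem_Icc, mem_Ioc, mem_singleton_iff]
      tauto
  have e₉ : sIntOn (slice2 μ (a₁, a₂) c₁) (Ioc c₂ d₂) (fun v => ν (Ioc c₁ d₁ ×ˢ {v})) =
      prodApply μ ν (coordRel (Icc a₁ c₁ ×ˢ Ioc c₁ d₁) (diagRel c₂ d₂)) := by
    refine sIntOn_slice2_apply μ ν _ _ ?_ (measurableSet_coordRel (hV _ _ _) (hZ _ _)) ?_
    · convert! (hsnd (hZ c₂ d₂)).inter
        (measurable_snd.fst (measurableSet_Ioc (a := c₁) (b := d₁))) using 1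
      ext ⟨u, q₁, q₂⟩
      simp only [diagRel, mem_ofPred_eq, mem_prod, mem_Ioc, mem_inter_iff, mem_preimage,
        mem_singleton_iff]
      tauto
    · rintro ⟨p₁, p₂⟩ ⟨q₁, q₂⟩
      simp only [coordRel, diagRel, mem_ofPred_eq, mem_prod, mem_Icc, mem_Ioc, mem_singleton_iff]
      tauto
  have key := sum_mul_prodApply_eq_zero μ ν
    ![-1, 1, 1, -1, -1, 1, -1, 1, -1, 1, 1, 1, 1, 1, 1]
    (S := ![coordRel (leRel a₁ c₁ d₁) (leRel a₂ c₂ d₂),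
      coordRel (geRel a₁ c₁ d₁) (geRel a₂ c₂ d₂),
      coordRel (Icc a₁ d₁ ×ˢ Icc a₁ d₁) (Icc a₂ d₂ ×ˢ Icc a₂ d₂),
      coordRel (Icc a₁ c₁ ×ˢ Icc a₁ c₁) (Icc a₂ d₂ ×ˢ Icc a₂ d₂),
      coordRel (Icc a₁ d₁ ×ˢ Icc a₁ d₁) (Icc a₂ c₂ ×ˢ Icc a₂ c₂),
      coordRel (Icc a₁ c₁ ×ˢ Icc a₁ c₁) (Icc a₂ c₂ ×ˢ Icc a₂ c₂),
      coordRel (geRel a₁ c₁ d₁) (Icc a₂ d₂ ×ˢ Icc a₂ d₂),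
      coordRel (geRel a₁ c₁ d₁) (Icc a₂ c₂ ×ˢ Icc a₂ c₂),
      coordRel (Icc a₁ d₁ ×ˢ Icc a₁ d₁) (geRel a₂ c₂ d₂),
      coordRel (Icc a₁ c₁ ×ˢ Icc a₁ c₁) (geRel a₂ c₂ d₂),
      coordRel (diagRel c₁ d₁) (ltRel c₂ d₂),
      coordRel (ltRel c₁ d₁) (diagRel c₂ d₂),
      coordRel (diagRel c₁ d₁) (diagRel c₂ d₂),
      coordRel (diagRel c₁ d₁) (Icc a₂ c₂ ×ˢ Ioc c₂ d₂),
      coordRel (Icc a₁ c₁ ×ˢ Ioc c₁ d₁) (diagRel c₂ d₂)])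
    (by
      intro i
      fin_cases i <;> apply measurableSet_coordRel <;>
        first
        | exact hX _ _ _ | exact hY _ _ _ | exact hZ _ _ | exact hW _ _
        | exact hN _ _ | exact hV _ _ _)
    (by
      intro z
      have h₁ := indicator_Icc_prod_sub hac₁ hcd₁ (z.1.1, z.2.1)
      have h₂ := indicator_Icc_prod_sub hac₂ hcd₂ (z.1.2, z.2.2)
      have k₁ := indicator_leRel (d := d₁) hac₁ (z.1.1, z.2.1)
      have k₂ := indicator_leRel (d := d₂) hac₂ (z.1.2, z.2.2)
      simp only [Fin.sum_univ_succ, Fin.sum_univ_zero, Matrix.cons_val_zero, Matrix.cons_val_succ,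
        indicator_coordRel]
      generalize (Icc a₁ d₁ ×ˢ Icc a₁ d₁).indicator (1 : ℝ × ℝ → ℝ) (z.1.1, z.2.1) = D₁ at *
      generalize (Icc a₂ d₂ ×ˢ Icc a₂ d₂).indicator (1 : ℝ × ℝ → ℝ) (z.1.2, z.2.2) = D₂ at *
      rw [sub_eq_iff_eq_add] at h₁ h₂
      rw [h₁, h₂, k₁, k₂]
      ring)
  simp only [Fin.sum_univ_succ, Fin.sum_univ_zero, Matrix.cons_val_zero,
    Matrix.cons_val_succ] at key
  simp only [Δ4, cdf2_mul_cdf2]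
  rw [e₀, e₁, e₃, e₃, e₅, e₅, e₇, e₈, e₉]
  linarith

end BBV
end
end

section
/- Let [a,b] ⊂ ℝ² be a compact rectangle, let μ, ν be finite signed Borel measures on [a,b], and put f(x) = μ([a,x]), g(x) = ν([a,x]) for x ∈ [a,b]. Assume additionally that at least one of f and g is continuous on [a,b]. Then for every half-open rectangle (c,d] ⊆ [a,b] with c < d: ∫_{(c,d]} f dν = ∫_{(c,d]} g dμ + Δ(fg, c₁,c₂,d₁,d₂) − ∫_{(c₁,d₁]} g(u,d₂) f(du,d₂) + ∫_{(c₁,d₁]} g(u,c₂) f(du,c₂) − ∫_{(c₂,d₂]} g(d₁,v) f(d₁,dv) + ∫_{(c₂,d₂]} g(c₁,v) f(c₁,dv). -/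
open MeasureTheory Set

noncomputable section

namespace BBV

/-- Bounded measurable real functions. -/
def BddMeas {α : Type*} [MeasurableSpace α] (h : α → ℝ) : Prop :=
  Measurable h ∧ ∃ C, ∀ x, |h x| ≤ C

section SignedIntegral

variable {α β : Type*} [MeasurableSpace α] [MeasurableSpace β]

namespace BddMeas

variable {h k : α → ℝ}

lemma integrable (hh : BddMeas h) (m : Measure α) [IsFiniteMeasure m] : Integrable h m := by
  obtain ⟨hm, C, hC⟩ := hh
  exact Integrable.of_bound hm.aestronglyMeasurable C (.of_forall hC)

lemma add (hh : BddMeas h) (hk : BddMeas k) : BddMeas (fun x => h x + k x) := by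
  obtain ⟨hm, C, hC⟩ := hh
  obtain ⟨km, D, hD⟩ := hk
  exact ⟨hm.add km, C + D, fun x => (abs_add_le _ _).trans (add_le_add (hC x) (hD x))⟩

lemma sub (hh : BddMeas h) (hk : BddMeas k) : BddMeas (fun x => h x - k x) := by
  obtain ⟨hm, C, hC⟩ := hh
  obtain ⟨km, D, hD⟩ := hk
  exact ⟨hm.sub km, C + D, fun x => (abs_sub _ _).trans (add_le_add (hC x) (hD x))⟩

lemma mul (hh : BddMeas h) (hk : BddMeas k) : BddMeas (fun x => h x * k x) := by
  obtain ⟨hm, C, hC⟩ := hh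
  obtain ⟨km, D, hD⟩ := hk
  refine ⟨hm.mul km, C * D, fun x => ?_⟩
  rw [abs_mul]
  exact mul_le_mul (hC x) (hD x) (abs_nonneg _) ((abs_nonneg _).trans (hC x))

lemma comp (hh : BddMeas h) {φ : β → α} (hφ : Measurable φ) : BddMeas (fun x => h (φ x)) :=
  ⟨hh.1.comp hφ, hh.2.imp fun _ hC x => hC (φ x)⟩

lemma indicator (hh : BddMeas h) {s : Set α} (hs : MeasurableSet s) : BddMeas (s.indicator h) := by
  obtain ⟨hm, C, hC⟩ := hh
  refine ⟨hm.indicator hs, C, fun x => ?_⟩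
  by_cases hx : x ∈ s
  · simpa [hx] using hC x
  · simpa [hx] using (abs_nonneg _).trans (hC x)

lemma const (c : ℝ) : BddMeas (fun _ : α => c) := ⟨measurable_const, |c|, fun _ => le_rfl⟩

lemma integral_right {K : α × β → ℝ} (hK : BddMeas K) (m : Measure β) [IsFiniteMeasure m] :
    BddMeas (fun x => ∫ y, K (x, y) ∂m) := by
  obtain ⟨hm, C, hC⟩ := hK
  refine ⟨(hm.stronglyMeasurable.integral_prod_right' (ν := m)).measurable, C * m.real univ,
    fun x => ?_⟩
  exact norm_integral_le_of_norm_le_const (f := fun y => K (x, y)) (.of_forall fun y => hC (x, y))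

lemma sInt_right {K : α × β → ℝ} (hK : BddMeas K) (ν : SignedMeasure β) :
    BddMeas (fun x => sInt ν (fun y => K (x, y))) :=
  (hK.integral_right _).sub (hK.integral_right _)

end BddMeas

variable {h k : α → ℝ}

lemma sInt_add (μ : SignedMeasure α) (hh : BddMeas h) (hk : BddMeas k) :
    sInt μ (fun x => h x + k x) = sInt μ h + sInt μ k := by
  simp only [sInt]
  rw [integral_add (hh.integrable _) (hk.integrable _),
    integral_add (hh.integrable _) (hk.integrable _)]
  ring

lemma sInt_sub (μ : SignedMeasure α) (hh : BddMeas h) (hk : BddMeas k) :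
    sInt μ (fun x => h x - k x) = sInt μ h - sInt μ k := by
  simp only [sInt]
  rw [integral_sub (hh.integrable _) (hk.integrable _),
    integral_sub (hh.integrable _) (hk.integrable _)]
  ring

lemma sInt_const_mul (μ : SignedMeasure α) (c : ℝ) (h : α → ℝ) :
    sInt μ (fun x => c * h x) = c * sInt μ h := by
  simp only [sInt, integral_const_mul]
  ring

lemma sInt_mul_const (μ : SignedMeasure α) (c : ℝ) (h : α → ℝ) :
    sInt μ (fun x => h x * c) = sInt μ h * c := by
  simp only [sInt, integral_mul_const]
  ring

@[simp] lemma sInt_zero (μ : SignedMeasure α) : sInt μ (fun _ => 0) = 0 := by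
  simp [sInt]

@[simp] lemma sInt_zero_measure (h : α → ℝ) : sInt (0 : SignedMeasure α) h = 0 := by
  simp [sInt, SignedMeasure.toJordanDecomposition_zero]

lemma posPart_sub_negPart (μ : SignedMeasure α) :
    μ = μ.toJordanDecomposition.posPart.toSignedMeasure -
      μ.toJordanDecomposition.negPart.toSignedMeasure :=
  μ.toSignedMeasure_toJordanDecomposition.symm

/-- The signed integral can be computed from any decomposition as a difference of two
finite measures. -/
lemma sInt_eq_of_eq_sub {μ : SignedMeasure α} {m n : Measure α} [IsFiniteMeasure m]
    [IsFiniteMeasure n] (hμ : μ = m.toSignedMeasure - n.toSignedMeasure) (hh : BddMeas h) :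
    sInt μ h = ∫ x, h x ∂m - ∫ x, h x ∂n := by
  have key : μ.toJordanDecomposition.posPart + n = m + μ.toJordanDecomposition.negPart := by
    rw [← Measure.toSignedMeasure_eq_toSignedMeasure_iff, Measure.toSignedMeasure_add,
      Measure.toSignedMeasure_add, ← sub_eq_sub_iff_add_eq_add, ← posPart_sub_negPart, hμ]
  have := congrArg (fun m => ∫ x, h x ∂m) key
  simp only [integral_add_measure (hh.integrable _) (hh.integrable _)] at this
  simp only [sInt]
  linarith

lemma sInt_indicator_one (μ : SignedMeasure α) {s : Set α} (hs : MeasurableSet s) :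
    sInt μ (s.indicator fun _ => 1) = μ s := by
  conv_rhs => rw [posPart_sub_negPart μ]
  simp [sInt, integral_indicator hs, Measure.toSignedMeasure_apply_measurable hs]

lemma sInt_restrict (μ : SignedMeasure α) {s : Set α} (hs : MeasurableSet s) (hh : BddMeas h) :
    sInt (μ.restrict s) h = sInt μ (s.indicator h) := by
  rw [sInt_eq_of_eq_sub (m := μ.toJordanDecomposition.posPart.restrict s)
    (n := μ.toJordanDecomposition.negPart.restrict s) ?_ hh, sInt, integral_indicator hs,
    integral_indicator hs]
  conv_lhs => rw [posPart_sub_negPart μ]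
  rw [VectorMeasure.restrict_sub,
    Measure.toSignedMeasure_restrict_eq_restrict_toSignedMeasure _ _ hs,
    Measure.toSignedMeasure_restrict_eq_restrict_toSignedMeasure _ _ hs]

lemma sInt_map (μ : SignedMeasure α) {φ : α → β} (hφ : Measurable φ) {h : β → ℝ}
    (hh : BddMeas h) : sInt (μ.map φ) h = sInt μ (fun x => h (φ x)) := by
  rw [sInt_eq_of_eq_sub (m := μ.toJordanDecomposition.posPart.map φ)
    (n := μ.toJordanDecomposition.negPart.map φ) ?_ hh, sInt,
    integral_map hφ.aemeasurable hh.1.aestronglyMeasurable,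
    integral_map hφ.aemeasurable hh.1.aestronglyMeasurable]
  ext s hs
  conv_lhs => rw [posPart_sub_negPart μ]
  rw [VectorMeasure.map_apply _ hφ hs]
  simp [Measure.toSignedMeasure_apply_measurable hs,
    Measure.toSignedMeasure_apply_measurable (hφ hs), measureReal_def, Measure.map_apply hφ hs]

/-- Fubini's theorem for signed measures. -/
lemma sInt_swap (μ : SignedMeasure α) (ν : SignedMeasure β) {K : α × β → ℝ} (hK : BddMeas K) :
    sInt μ (fun x => sInt ν (fun y => K (x, y))) =
      sInt ν (fun y => sInt μ (fun x => K (x, y))) := by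
  have hK' : BddMeas (fun z : β × α => K (z.2, z.1)) := hK.comp measurable_swap
  have swap (m : Measure α) (n : Measure β) [IsFiniteMeasure m] [IsFiniteMeasure n] :
      ∫ x, ∫ y, K (x, y) ∂n ∂m = ∫ y, ∫ x, K (x, y) ∂m ∂n :=
    integral_integral_swap (f := fun x y => K (x, y)) (hK.integrable _)
  simp only [sInt]
  rw [integral_sub ((hK.integral_right _).integrable _) ((hK.integral_right _).integrable _),
    integral_sub ((hK.integral_right _).integrable _) ((hK.integral_right _).integrable _),
    integral_sub ((hK'.integral_right _).integrable _) ((hK'.integral_right _).integrable _),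
    integral_sub ((hK'.integral_right _).integrable _) ((hK'.integral_right _).integrable _),
    swap, swap, swap, swap]
  ring

end SignedIntegral

section NullLines

/-- A signed measure on `ℝ` with continuous distribution function has no atoms. -/
lemma apply_singleton_eq_zero_of_continuousOn (μ : SignedMeasure ℝ) {a b t : ℝ}
    (hcont : ContinuousOn (fun x => μ (Icc a x)) (Icc a b)) (hat : a < t) (htb : t ≤ b) :
    μ {t} = 0 := by
  obtain ⟨u, hu, hut, hlim⟩ := exists_seq_strictMono_tendsto' hat
  have hunion : ⋃ n, Icc a (u n) = Ico a t := by
    ext x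
    simp only [mem_iUnion, mem_Icc, mem_Ico]
    constructor
    · rintro ⟨n, h1, h2⟩
      exact ⟨h1, h2.trans_lt (hut n).2⟩
    · rintro ⟨h1, h2⟩
      obtain ⟨n, hn⟩ := (hlim.eventually (lt_mem_nhds h2)).exists
      exact ⟨n, h1, hn.le⟩
  have h1 := VectorMeasure.tendsto_vectorMeasure_iUnion_atTop_nat (v := μ)
    (s := fun n => Icc a (u n)) (fun i j hij => Icc_subset_Icc_right (hu.monotone hij))
    (fun _ => measurableSet_Icc)
  have h2 : Filter.Tendsto (fun n => μ (Icc a (u n))) Filter.atTop (nhds (μ (Icc a t))) :=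
    (hcont t ⟨hat.le, htb⟩).tendsto.comp (tendsto_nhdsWithin_iff.2
      ⟨hlim, .of_forall fun n => ⟨(hut n).1.le, (hut n).2.le.trans htb⟩⟩)
  have h3 := tendsto_nhds_unique h1 h2
  have h4 := VectorMeasure.of_union (v := μ) (A := Ico a t) (B := {t})
    (by simp) measurableSet_Ico (measurableSet_singleton t)
  rw [Ico_union_right hat.le] at h4
  rw [hunion] at h3
  linarith

lemma eq_zero_of_apply_Icc {μ : SignedMeasure ℝ} {a b : ℝ}
    (hμ : ∀ s, MeasurableSet s → μ s = μ (s ∩ Icc a b))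
    (h : ∀ s ∈ Icc a b, μ (Icc a s) = 0) : μ = 0 := by
  have key (s : ℝ) : μ (Icc a (min s b)) = 0 := by
    by_cases hs : a ≤ min s b
    · exact h _ ⟨hs, min_le_right _ _⟩
    · rw [Icc_eq_empty hs, VectorMeasure.empty]
  refine VectorMeasure.ext_of_generateFrom (range Iic) ?_ ?_ isPiSystem_Iic ?_
  · rintro _ ⟨s, rfl⟩
    rw [hμ _ measurableSet_Iic]
    refine Eq.trans (congrArg μ ?_) (key s)
    ext x
    simp only [mem_inter_iff, mem_Iic, mem_Icc, le_min_iff]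
    tauto
  · rw [BorelSpace.measurable_eq (α := ℝ), borel_eq_generateFrom_Iic]
  · rw [hμ _ .univ]
    simpa using key b

/-- The part of `μ` on the vertical line through `t`, projected to the second coordinate. -/
def line1 (μ : SignedMeasure (ℝ × ℝ)) (t : ℝ) : SignedMeasure ℝ :=
  (μ.restrict ({t} ×ˢ univ)).map Prod.snd

/-- The part of `μ` on the horizontal line through `t`, projected to the first coordinate. -/
def line2 (μ : SignedMeasure (ℝ × ℝ)) (t : ℝ) : SignedMeasure ℝ :=
  (μ.restrict (univ ×ˢ {t})).map Prod.fst

lemma slice1_apply (μ : SignedMeasure (ℝ × ℝ)) (a : ℝ × ℝ) (y : ℝ) {s : Set ℝ}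
    (hs : MeasurableSet s) : slice1 μ a y s = μ (s ×ˢ Icc a.2 y) := by
  rw [slice1, VectorMeasure.map_apply _ measurable_fst hs,
    VectorMeasure.restrict_apply _ (MeasurableSet.univ.prod measurableSet_Icc) (measurable_fst hs)]
  congr 1
  ext
  simp

lemma slice2_apply (μ : SignedMeasure (ℝ × ℝ)) (a : ℝ × ℝ) (x : ℝ) {s : Set ℝ}
    (hs : MeasurableSet s) : slice2 μ a x s = μ (Icc a.1 x ×ˢ s) := by
  rw [slice2, VectorMeasure.map_apply _ measurable_snd hs,
    VectorMeasure.restrict_apply _ (measurableSet_Icc.prod MeasurableSet.univ) (measurable_snd hs)]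
  congr 1
  ext
  simp [and_comm]

lemma line1_apply (μ : SignedMeasure (ℝ × ℝ)) (t : ℝ) {s : Set ℝ}
    (hs : MeasurableSet s) : line1 μ t s = μ ({t} ×ˢ s) := by
  rw [line1, VectorMeasure.map_apply _ measurable_snd hs, VectorMeasure.restrict_apply _
    ((measurableSet_singleton t).prod MeasurableSet.univ) (measurable_snd hs)]
  congr 1
  ext
  simp [and_comm]

lemma line2_apply (μ : SignedMeasure (ℝ × ℝ)) (t : ℝ) {s : Set ℝ}
    (hs : MeasurableSet s) : line2 μ t s = μ (s ×ˢ {t}) := by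
  rw [line2, VectorMeasure.map_apply _ measurable_fst hs, VectorMeasure.restrict_apply _
    (MeasurableSet.univ.prod (measurableSet_singleton t)) (measurable_fst hs)]
  congr 1
  ext
  simp

variable {μ : SignedMeasure (ℝ × ℝ)} {a b : ℝ × ℝ}

lemma line1_eq_zero (hμ : LivesOn μ a b)
    (hcont : ContinuousOn (cdf2 μ a) (Icc a.1 b.1 ×ˢ Icc a.2 b.2)) {t : ℝ}
    (hat : a.1 < t) (htb : t ≤ b.1) : line1 μ t = 0 := by
  refine eq_zero_of_apply_Icc (a := a.2) (b := b.2) (fun s hs => ?_) fun s hs => ?_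
  · rw [line1_apply _ _ hs, line1_apply _ _ (hs.inter measurableSet_Icc),
      hμ _ ((measurableSet_singleton t).prod hs), prod_inter_prod,
      singleton_inter_of_mem (mem_Icc.2 ⟨hat.le, htb⟩)]
  · rw [line1_apply _ _ measurableSet_Icc, ← slice1_apply _ _ _ (measurableSet_singleton t)]
    refine apply_singleton_eq_zero_of_continuousOn _ ?_ hat htb
    simp_rw [slice1_apply _ _ _ measurableSet_Icc]
    exact hcont.comp (f := fun x => (x, s)) (by fun_prop) fun x hx => mk_mem_prod hx hs

lemma line2_eq_zero (hμ : LivesOn μ a b)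
    (hcont : ContinuousOn (cdf2 μ a) (Icc a.1 b.1 ×ˢ Icc a.2 b.2)) {t : ℝ}
    (hat : a.2 < t) (htb : t ≤ b.2) : line2 μ t = 0 := by
  refine eq_zero_of_apply_Icc (a := a.1) (b := b.1) (fun s hs => ?_) fun s hs => ?_
  · rw [line2_apply _ _ hs, line2_apply _ _ (hs.inter measurableSet_Icc),
      hμ _ (hs.prod (measurableSet_singleton t)), prod_inter_prod,
      singleton_inter_of_mem (mem_Icc.2 ⟨hat.le, htb⟩)]
  · rw [line2_apply _ _ measurableSet_Icc, ← slice2_apply _ _ _ (measurableSet_singleton t)]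
    refine apply_singleton_eq_zero_of_continuousOn _ ?_ hat htb
    simp_rw [slice2_apply _ _ _ measurableSet_Icc]
    exact hcont.comp (f := fun x => (s, x)) (by fun_prop) fun x hx => mk_mem_prod hs hx

lemma sInt_line1 (μ : SignedMeasure (ℝ × ℝ)) (t : ℝ) {h : ℝ → ℝ} (hh : BddMeas h) :
    sInt (line1 μ t) h = sInt μ (({t} ×ˢ univ).indicator fun x => h x.2) := by
  rw [line1, sInt_map _ measurable_snd hh, sInt_restrict _
    ((measurableSet_singleton t).prod MeasurableSet.univ) (hh.comp measurable_snd)]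

lemma sInt_line2 (μ : SignedMeasure (ℝ × ℝ)) (t : ℝ) {h : ℝ → ℝ} (hh : BddMeas h) :
    sInt (line2 μ t) h = sInt μ ((univ ×ˢ {t}).indicator fun x => h x.1) := by
  rw [line2, sInt_map _ measurable_fst hh, sInt_restrict _
    (MeasurableSet.univ.prod (measurableSet_singleton t)) (hh.comp measurable_fst)]

end NullLines

section Kernels

/-- The indicator of `{(s, t) | s ∈ (c, d], t ∈ [a, s]}`. -/
def triKer (a c d : ℝ) (z : ℝ × ℝ) : ℝ :=
  {z : ℝ × ℝ | (c < z.1 ∧ z.1 ≤ d) ∧ a ≤ z.2 ∧ z.2 ≤ z.1}.indicator (fun _ => 1) z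

/-- The indicator of the square `[a, d] × [a, d]`. -/
def boxKer (a d : ℝ) (z : ℝ × ℝ) : ℝ := (Icc a d ×ˢ Icc a d).indicator (fun _ => 1) z

/-- The indicator of the diagonal of `(c, d] × (c, d]`. -/
def diagKer (c d : ℝ) (z : ℝ × ℝ) : ℝ :=
  {z : ℝ × ℝ | (c < z.1 ∧ z.1 ≤ d) ∧ z.2 = z.1}.indicator (fun _ => 1) z

lemma bddMeas_triKer (a c d : ℝ) : BddMeas (triKer a c d) := by
  refine (BddMeas.const 1).indicator (.inter (.inter ?_ ?_) (.inter ?_ ?_))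
  · exact measurableSet_lt measurable_const measurable_fst
  · exact measurableSet_le measurable_fst measurable_const
  · exact measurableSet_le measurable_const measurable_snd
  · exact measurableSet_le measurable_snd measurable_fst

lemma bddMeas_boxKer (a d : ℝ) : BddMeas (boxKer a d) :=
  (BddMeas.const 1).indicator (measurableSet_Icc.prod measurableSet_Icc)

lemma bddMeas_diagKer (c d : ℝ) : BddMeas (diagKer c d) := by
  refine (BddMeas.const 1).indicator (.inter (.inter ?_ ?_) ?_)
  · exact measurableSet_lt measurable_const measurable_fst
  · exact measurableSet_le measurable_fst measurable_const
  · exact measurableSet_eq_fun measurable_snd measurable_fst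

lemma boxKer_sub_boxKer {a c d : ℝ} (hac : a ≤ c) (hcd : c ≤ d) (s t : ℝ) :
    boxKer a d (s, t) - boxKer a c (s, t) =
      triKer a c d (s, t) + triKer a c d (t, s) - diagKer c d (s, t) := by
  simp only [boxKer, triKer, diagKer, indicator_apply, mem_prod, mem_Icc, mem_ofPred_eq]
  grind

lemma diagKer_swap (c d s t : ℝ) : diagKer c d (s, t) = diagKer c d (t, s) := by
  simp only [diagKer, indicator_apply, mem_ofPred_eq]
  grind

/-- The product kernel `(x, y) ↦ k (x₁, y₁) * l (x₂, y₂)`. -/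
def prodKer (k l : ℝ × ℝ → ℝ) (z : (ℝ × ℝ) × (ℝ × ℝ)) : ℝ :=
  k (z.1.1, z.2.1) * l (z.1.2, z.2.2)

lemma BddMeas.prodKer {k l : ℝ × ℝ → ℝ} (hk : BddMeas k) (hl : BddMeas l) :
    BddMeas (prodKer k l) :=
  (hk.comp (φ := fun z : (ℝ × ℝ) × (ℝ × ℝ) => (z.1.1, z.2.1)) (by fun_prop)).mul
    (hl.comp (φ := fun z : (ℝ × ℝ) × (ℝ × ℝ) => (z.1.2, z.2.2)) (by fun_prop))

/-- The iterated integral of a kernel against two signed measures. -/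
def dInt {α β : Type*} [MeasurableSpace α] [MeasurableSpace β] (μ : SignedMeasure α)
    (ν : SignedMeasure β) (K : α × β → ℝ) : ℝ :=
  sInt μ fun x => sInt ν fun y => K (x, y)

section

variable {α β : Type*} [MeasurableSpace α] [MeasurableSpace β] (μ : SignedMeasure α)
  (ν : SignedMeasure β) {K L : α × β → ℝ}

lemma dInt_add (hK : BddMeas K) (hL : BddMeas L) :
    dInt μ ν (fun z => K z + L z) = dInt μ ν K + dInt μ ν L := by
  simp only [dInt]
  rw [← sInt_add _ (hK.sInt_right _) (hL.sInt_right _)]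
  congr! 2 with x
  exact sInt_add _ (hK.comp (by fun_prop)) (hL.comp (by fun_prop))

lemma dInt_sub (hK : BddMeas K) (hL : BddMeas L) :
    dInt μ ν (fun z => K z - L z) = dInt μ ν K - dInt μ ν L := by
  simp only [dInt]
  rw [← sInt_sub _ (hK.sInt_right _) (hL.sInt_right _)]
  congr! 2 with x
  exact sInt_sub _ (hK.comp (by fun_prop)) (hL.comp (by fun_prop))

lemma dInt_swap (hK : BddMeas K) : dInt μ ν K = dInt ν μ (fun z => K z.swap) :=
  sInt_swap μ ν hK

end

variable (μ ν : SignedMeasure (ℝ × ℝ)) (a c d : ℝ × ℝ)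

lemma indicator_cdf2 (x : ℝ × ℝ) :
    (Ioc c.1 d.1 ×ˢ Ioc c.2 d.2).indicator (cdf2 μ a) x =
      sInt μ fun y => prodKer (triKer a.1 c.1 d.1) (triKer a.2 c.2 d.2) (x, y) := by
  by_cases hx : x ∈ Ioc c.1 d.1 ×ˢ Ioc c.2 d.2
  · rw [indicator_of_mem hx, cdf2,
      ← sInt_indicator_one _ (measurableSet_Icc.prod measurableSet_Icc)]
    congr! 2 with y
    simp only [mem_prod, mem_Ioc] at hx
    simp only [prodKer, triKer, indicator_apply, mem_prod, mem_Icc, mem_ofPred_eq]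
    grind
  · rw [indicator_of_notMem hx, ← sInt_zero μ]
    congr! 2 with y
    simp only [mem_prod, mem_Ioc] at hx
    simp only [prodKer, triKer, indicator_apply, mem_ofPred_eq]
    grind

lemma sIntOn_cdf2 : sIntOn μ (Ioc c.1 d.1 ×ˢ Ioc c.2 d.2) (cdf2 ν a) =
    dInt μ ν (prodKer (triKer a.1 c.1 d.1) (triKer a.2 c.2 d.2)) := by
  simp only [sIntOn, dInt, ← indicator_cdf2]

lemma cdf2_mul_cdf2_s16 (z : ℝ × ℝ) :
    cdf2 μ a z * cdf2 ν a z = dInt μ ν (prodKer (boxKer a.1 z.1) (boxKer a.2 z.2)) := by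
  have hs : MeasurableSet (Icc a.1 z.1 ×ˢ Icc a.2 z.2) := measurableSet_Icc.prod measurableSet_Icc
  rw [cdf2, cdf2, ← sInt_indicator_one _ hs, ← sInt_mul_const, dInt]
  congr! 2 with x
  rw [← sInt_indicator_one _ hs, ← sInt_const_mul]
  congr! 2 with y
  simp only [prodKer, boxKer, indicator_apply, mem_prod]
  grind

lemma indicator_cdf2_fst (w u : ℝ) :
    (Ioc c.1 d.1).indicator (fun u => cdf2 ν a (u, w)) u =
      sInt ν fun y => triKer a.1 c.1 d.1 (u, y.1) * (Icc a.2 w).indicator (fun _ => 1) y.2 := by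
  by_cases hu : u ∈ Ioc c.1 d.1
  · rw [indicator_of_mem hu, cdf2,
      ← sInt_indicator_one _ (measurableSet_Icc.prod measurableSet_Icc)]
    congr! 2 with y
    simp only [mem_Ioc] at hu
    simp only [triKer, indicator_apply, mem_prod, mem_Icc, mem_ofPred_eq]
    grind
  · rw [indicator_of_notMem hu, ← sInt_zero ν]
    congr! 2 with y
    simp only [mem_Ioc] at hu
    simp only [triKer, indicator_apply, mem_ofPred_eq]
    grind

lemma indicator_cdf2_snd (w u : ℝ) :
    (Ioc c.2 d.2).indicator (fun u => cdf2 ν a (w, u)) u =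
      sInt ν fun y => (Icc a.1 w).indicator (fun _ => 1) y.1 * triKer a.2 c.2 d.2 (u, y.2) := by
  by_cases hu : u ∈ Ioc c.2 d.2
  · rw [indicator_of_mem hu, cdf2,
      ← sInt_indicator_one _ (measurableSet_Icc.prod measurableSet_Icc)]
    congr! 2 with y
    simp only [mem_Ioc] at hu
    simp only [triKer, indicator_apply, mem_prod, mem_Icc, mem_ofPred_eq]
    grind
  · rw [indicator_of_notMem hu, ← sInt_zero ν]
    congr! 2 with y
    simp only [mem_Ioc] at hu
    simp only [triKer, indicator_apply, mem_ofPred_eq]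
    grind

lemma sIntOn_slice1 (w : ℝ) :
    sIntOn (slice1 μ a w) (Ioc c.1 d.1) (fun u => cdf2 ν a (u, w)) =
      dInt μ ν (prodKer (triKer a.1 c.1 d.1) (boxKer a.2 w)) := by
  have hIcc : BddMeas ((Icc a.2 w).indicator fun _ => (1 : ℝ)) :=
    (BddMeas.const 1).indicator measurableSet_Icc
  have hK : BddMeas fun z : ℝ × (ℝ × ℝ) =>
      triKer a.1 c.1 d.1 (z.1, z.2.1) * (Icc a.2 w).indicator (fun _ => 1) z.2.2 :=
    ((bddMeas_triKer a.1 c.1 d.1).comp (φ := fun z : ℝ × (ℝ × ℝ) => (z.1, z.2.1))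
      (by fun_prop)).mul (hIcc.comp (φ := fun z : ℝ × (ℝ × ℝ) => z.2.2) (by fun_prop))
  simp only [sIntOn, funext (indicator_cdf2_fst ν a c d w)]
  rw [slice1, sInt_map _ measurable_fst (hK.sInt_right ν),
    sInt_restrict _ (MeasurableSet.univ.prod measurableSet_Icc)
      ((hK.sInt_right ν).comp measurable_fst), dInt]
  congr 1
  ext x
  by_cases hx : x.2 ∈ Icc a.2 w
  · rw [indicator_of_mem (by simpa using hx)]
    congr! 2 with y
    simp only [prodKer, boxKer, indicator_apply, mem_prod]
    grind
  · rw [indicator_of_notMem (by simpa using hx), ← sInt_zero ν]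
    congr! 2 with y
    simp only [prodKer, boxKer, indicator_apply, mem_prod]
    grind

lemma sIntOn_slice2 (w : ℝ) :
    sIntOn (slice2 μ a w) (Ioc c.2 d.2) (fun u => cdf2 ν a (w, u)) =
      dInt μ ν (prodKer (boxKer a.1 w) (triKer a.2 c.2 d.2)) := by
  have hIcc : BddMeas ((Icc a.1 w).indicator fun _ => (1 : ℝ)) :=
    (BddMeas.const 1).indicator measurableSet_Icc
  have hK : BddMeas fun z : ℝ × (ℝ × ℝ) =>
      (Icc a.1 w).indicator (fun _ => 1) z.2.1 * triKer a.2 c.2 d.2 (z.1, z.2.2) :=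
    (hIcc.comp (φ := fun z : ℝ × (ℝ × ℝ) => z.2.1) (by fun_prop)).mul
      ((bddMeas_triKer a.2 c.2 d.2).comp (φ := fun z : ℝ × (ℝ × ℝ) => (z.1, z.2.2))
        (by fun_prop))
  simp only [sIntOn, funext (indicator_cdf2_snd ν a c d w)]
  rw [slice2, sInt_map _ measurable_snd (hK.sInt_right ν),
    sInt_restrict _ (measurableSet_Icc.prod MeasurableSet.univ)
      ((hK.sInt_right ν).comp measurable_snd), dInt]
  congr 1
  ext x
  by_cases hx : x.1 ∈ Icc a.1 w
  · rw [indicator_of_mem (by simpa using hx)]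
    congr! 2 with y
    simp only [prodKer, boxKer, indicator_apply, mem_prod]
    grind
  · rw [indicator_of_notMem (by simpa using hx), ← sInt_zero ν]
    congr! 2 with y
    simp only [prodKer, boxKer, indicator_apply, mem_prod]
    grind

variable {μ ν}

lemma dInt_diagKer_left_eq_zero_of_right {c d : ℝ} (hν : ∀ t ∈ Ioc c d, line1 ν t = 0)
    {l : ℝ × ℝ → ℝ} (hl : BddMeas l) : dInt μ ν (prodKer (diagKer c d) l) = 0 := by
  rw [dInt, ← sInt_zero μ]
  congr 1
  ext x
  by_cases hx : x.1 ∈ Ioc c d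
  · rw [← sInt_zero_measure (fun t => l (x.2, t)), ← hν _ hx,
      sInt_line1 _ _ (hl.comp (by fun_prop))]
    congr 1
    ext y
    simp only [prodKer, diagKer, indicator_apply, mem_prod, mem_ofPred_eq, mem_singleton_iff,
      mem_univ, and_true, ← mem_Ioc, hx, true_and, ite_mul, one_mul, zero_mul]
  · rw [← sInt_zero ν]
    congr 1
    ext y
    simp only [prodKer, diagKer, indicator_apply, mem_ofPred_eq, ← mem_Ioc, hx, false_and,
      if_false, zero_mul]

lemma dInt_diagKer_right_eq_zero_of_right {c d : ℝ} (hν : ∀ t ∈ Ioc c d, line2 ν t = 0)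
    {k : ℝ × ℝ → ℝ} (hk : BddMeas k) : dInt μ ν (prodKer k (diagKer c d)) = 0 := by
  rw [dInt, ← sInt_zero μ]
  congr 1
  ext x
  by_cases hx : x.2 ∈ Ioc c d
  · rw [← sInt_zero_measure (fun t => k (x.1, t)), ← hν _ hx,
      sInt_line2 _ _ (hk.comp (by fun_prop))]
    congr 1
    ext y
    simp only [prodKer, diagKer, indicator_apply, mem_prod, mem_ofPred_eq, mem_singleton_iff,
      mem_univ, true_and, ← mem_Ioc, hx, mul_ite, mul_one, mul_zero]
  · rw [← sInt_zero ν]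
    congr 1
    ext y
    simp only [prodKer, diagKer, indicator_apply, mem_ofPred_eq, ← mem_Ioc, hx, false_and,
      if_false, mul_zero]

lemma dInt_diagKer_left_eq_zero {c d : ℝ}
    (h : (∀ t ∈ Ioc c d, line1 μ t = 0) ∨ ∀ t ∈ Ioc c d, line1 ν t = 0)
    {l : ℝ × ℝ → ℝ} (hl : BddMeas l) : dInt μ ν (prodKer (diagKer c d) l) = 0 := by
  rcases h with hμ | hν
  · rw [dInt_swap _ _ ((bddMeas_diagKer c d).prodKer hl),
      ← dInt_diagKer_left_eq_zero_of_right (μ := ν) hμ (hl.comp measurable_swap)]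
    congr 1
    ext z
    simp [prodKer, diagKer_swap c d z.1.1]
  · exact dInt_diagKer_left_eq_zero_of_right hν hl

lemma dInt_diagKer_right_eq_zero {c d : ℝ}
    (h : (∀ t ∈ Ioc c d, line2 μ t = 0) ∨ ∀ t ∈ Ioc c d, line2 ν t = 0)
    {k : ℝ × ℝ → ℝ} (hk : BddMeas k) : dInt μ ν (prodKer k (diagKer c d)) = 0 := by
  rcases h with hμ | hν
  · rw [dInt_swap _ _ (hk.prodKer (bddMeas_diagKer c d)),
      ← dInt_diagKer_right_eq_zero_of_right (μ := ν) hμ (hk.comp measurable_swap)]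
    congr 1
    ext z
    simp [prodKer, diagKer_swap c d z.1.2]
  · exact dInt_diagKer_right_eq_zero_of_right hν hk

end Kernels

/-- Corollary A.7 (integration by parts for two-variate Lebesgue–Stieltjes integrals)
when at least one of the two "c.d.f.s" is continuous: the atomic correction terms vanish. -/
theorem integration_by_parts_two_dimensional_continuous
    (a b : ℝ × ℝ) (hab : a.1 ≤ b.1 ∧ a.2 ≤ b.2)
    (μ ν : SignedMeasure (ℝ × ℝ)) (hμ : LivesOn μ a b) (hν : LivesOn ν a b)
    (hcontinuous : ContinuousOn (cdf2 μ a) (Icc a.1 b.1 ×ˢ Icc a.2 b.2) ∨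
      ContinuousOn (cdf2 ν a) (Icc a.1 b.1 ×ˢ Icc a.2 b.2))
    (c d : ℝ × ℝ) (hcd : c.1 < d.1 ∧ c.2 < d.2)
    (hac : a.1 ≤ c.1 ∧ a.2 ≤ c.2) (hdb : d.1 ≤ b.1 ∧ d.2 ≤ b.2) :
    sIntOn ν (Ioc c.1 d.1 ×ˢ Ioc c.2 d.2) (cdf2 μ a) =
      sIntOn μ (Ioc c.1 d.1 ×ˢ Ioc c.2 d.2) (cdf2 ν a)
        + Δ4 (fun x => cdf2 μ a x * cdf2 ν a x) c.1 c.2 d.1 d.2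
        - sIntOn (slice1 μ a d.2) (Ioc c.1 d.1) (fun u => cdf2 ν a (u, d.2))
        + sIntOn (slice1 μ a c.2) (Ioc c.1 d.1) (fun u => cdf2 ν a (u, c.2))
        - sIntOn (slice2 μ a d.1) (Ioc c.2 d.2) (fun v => cdf2 ν a (d.1, v))
        + sIntOn (slice2 μ a c.1) (Ioc c.2 d.2) (fun v => cdf2 ν a (c.1, v)) := by
  have hT₁ := bddMeas_triKer a.1 c.1 d.1
  have hT₂ := bddMeas_triKer a.2 c.2 d.2
  have hB₁ := bddMeas_boxKer a.1
  have hB₂ := bddMeas_boxKer a.2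
  have hE₁ := bddMeas_diagKer c.1 d.1
  have hE₂ := bddMeas_diagKer c.2 d.2
  have hS₁ : BddMeas fun z : ℝ × ℝ => triKer a.1 c.1 d.1 z.swap := hT₁.comp measurable_swap
  have hS₂ : BddMeas fun z : ℝ × ℝ => triKer a.2 c.2 d.2 z.swap := hT₂.comp measurable_swap
  have line₁ : (∀ t ∈ Ioc c.1 d.1, line1 μ t = 0) ∨ ∀ t ∈ Ioc c.1 d.1, line1 ν t = 0 :=
    hcontinuous.imp
      (fun h t ht => line1_eq_zero hμ h (hac.1.trans_lt ht.1) (ht.2.trans hdb.1))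
      (fun h t ht => line1_eq_zero hν h (hac.1.trans_lt ht.1) (ht.2.trans hdb.1))
  have line₂ : (∀ t ∈ Ioc c.2 d.2, line2 μ t = 0) ∨ ∀ t ∈ Ioc c.2 d.2, line2 ν t = 0 :=
    hcontinuous.imp
      (fun h t ht => line2_eq_zero hμ h (hac.2.trans_lt ht.1) (ht.2.trans hdb.2))
      (fun h t ht => line2_eq_zero hν h (hac.2.trans_lt ht.1) (ht.2.trans hdb.2))
  have z₁ := dInt_diagKer_left_eq_zero line₁ hS₂
  have z₂ := dInt_diagKer_right_eq_zero line₂ hS₁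
  have z₃ := dInt_diagKer_left_eq_zero line₁ hE₂
  have hL := sIntOn_cdf2 ν μ a c d
  rw [dInt_swap _ _ (hT₁.prodKer hT₂)] at hL
  have expand : dInt μ ν (fun z => prodKer (triKer a.1 c.1 d.1) (triKer a.2 c.2 d.2) z.swap) =
      dInt μ ν (fun z =>
        prodKer (triKer a.1 c.1 d.1) (triKer a.2 c.2 d.2) z
        + (prodKer (boxKer a.1 d.1) (boxKer a.2 d.2) z
          - prodKer (boxKer a.1 c.1) (boxKer a.2 d.2) z
          - prodKer (boxKer a.1 d.1) (boxKer a.2 c.2) z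
          + prodKer (boxKer a.1 c.1) (boxKer a.2 c.2) z)
        - prodKer (triKer a.1 c.1 d.1) (boxKer a.2 d.2) z
        + prodKer (triKer a.1 c.1 d.1) (boxKer a.2 c.2) z
        - prodKer (boxKer a.1 d.1) (triKer a.2 c.2 d.2) z
        + prodKer (boxKer a.1 c.1) (triKer a.2 c.2 d.2) z
        + prodKer (diagKer c.1 d.1) (fun z => triKer a.2 c.2 d.2 z.swap) z
        + prodKer (fun z => triKer a.1 c.1 d.1 z.swap) (diagKer c.2 d.2) z
        - prodKer (diagKer c.1 d.1) (diagKer c.2 d.2) z) := by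
    congr 1
    ext ⟨x, y⟩
    have h₁ := boxKer_sub_boxKer hac.1 hcd.1.le x.1 y.1
    have h₂ := boxKer_sub_boxKer hac.2 hcd.2.le x.2 y.2
    simp only [prodKer, Prod.swap_prod_mk]
    rw [sub_eq_iff_eq_add] at h₁ h₂
    rw [h₁, h₂]
    ring
  have h₁ := hT₁.prodKer hT₂
  have h₂ := (hB₁ d.1).prodKer (hB₂ d.2)
  have h₃ := (hB₁ c.1).prodKer (hB₂ d.2)
  have h₄ := (hB₁ d.1).prodKer (hB₂ c.2)
  have h₅ := (hB₁ c.1).prodKer (hB₂ c.2)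
  have h₆ := hT₁.prodKer (hB₂ d.2)
  have h₇ := hT₁.prodKer (hB₂ c.2)
  have h₈ := (hB₁ d.1).prodKer hT₂
  have h₉ := (hB₁ c.1).prodKer hT₂
  have hΔ := ((h₂.sub h₃).sub h₄).add h₅
  have s₁ := h₁.add hΔ
  have s₂ := s₁.sub h₆
  have s₃ := s₂.add h₇
  have s₄ := s₃.sub h₈
  have s₅ := s₄.add h₉
  have s₆ := s₅.add (hE₁.prodKer hS₂)
  have s₇ := s₆.add (hS₁.prodKer hE₂)
  rw [dInt_sub _ _ s₇ (hE₁.prodKer hE₂), dInt_add _ _ s₆ (hS₁.prodKer hE₂),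
    dInt_add _ _ s₅ (hE₁.prodKer hS₂), dInt_add _ _ s₄ h₉, dInt_sub _ _ s₃ h₈,
    dInt_add _ _ s₂ h₇, dInt_sub _ _ s₁ h₆, dInt_add _ _ h₁ hΔ,
    dInt_add _ _ ((h₂.sub h₃).sub h₄) h₅, dInt_sub _ _ (h₂.sub h₃) h₄, dInt_sub _ _ h₂ h₃,
    z₁, z₂, z₃] at expand
  rw [hL, expand]
  simp only [Δ4, sIntOn_cdf2, cdf2_mul_cdf2_s16, sIntOn_slice1, sIntOn_slice2]
  ring

end BBV
end
end
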